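/- For every matroid M with finite ground set E and rank r+1, the h-vector of the broken circuit complex of M is flawless: if d is the largest index with h_d ≠ 0 (assuming some h_k is nonzero), then h_k ≤ h_{d−k} for all 0 ≤ k ≤ d/2. -/

import Mathlib

open Polynomial

/-- The rank of a set `X` in a matroid `M`: the supremum of the cardinalities of the
independent subsets of `X`. -/
noncomputable def matroidRank {α : Type*} (M : Matroid α) (X : Set α) : ℕ :=
  sSup {m | ∃ I ⊆ X, M.Indep I ∧ I.ncard = m}

/-- The characteristic polynomial of a matroid `M` of rank `r + 1` whose ground set is a
finite type `α` :  `χ_M(q) = Σ_{S ⊆ E} (−1)^{|S|} q^{(r+1) − rk(S)}`. -/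
noncomputable def matroidCharPoly {α : Type*} [Fintype α] (M : Matroid α) (r : ℕ) :
    Polynomial ℤ :=
  ∑ S : Finset α, (-1 : Polynomial ℤ) ^ S.card * X ^ (r + 1 - matroidRank M ↑S)

/-- The polynomial `X ^ i + X ^ (i + 1) + ⋯ + X ^ (i + a - 1)`. -/
noncomputable def seg (i a : ℕ) : ℤ[X] := X ^ i * ∑ k ∈ Finset.range a, X ^ k

theorem coeff_seg (i a k : ℕ) : (seg i a).coeff k = if i ≤ k ∧ k < i + a then 1 else 0 := by
  rw [seg, coeff_X_pow_mul', finsetSum_coeff]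
  simp only [coeff_X_pow, Finset.sum_ite_eq, Finset.mem_range]
  split_ifs <;> first | rfl | omega

theorem seg_zero (i : ℕ) : seg i 0 = 0 := by simp [seg]

theorem seg_one (i : ℕ) : seg i 1 = X ^ i := by simp [seg]

theorem X_mul_seg (i a : ℕ) : X * seg i a = seg (i + 1) a := by
  rw [seg, seg, pow_succ']; ring

theorem seg_mul_seg_succ (i j a b : ℕ) :
    seg i (a + 1) * seg j (b + 1) = seg (i + j) (a + b + 1) + X * (seg i a * seg j b) := by
  induction b with
  | zero => simp [seg, pow_add]; ring
  | succ b ih =>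
    simp only [seg, ← add_assoc] at ih ⊢
    have e : ∀ n, ∑ k ∈ Finset.range (n + 1), (X : ℤ[X]) ^ k =
        ∑ k ∈ Finset.range n, X ^ k + X ^ n := fun n ↦ Finset.sum_range_succ _ n
    rw [e (b + 1), e (a + b + 1), mul_add, mul_add, mul_add, ih, e b, e a]
    ring

/-- The cone of sums of segments whose midpoint is at least `d / 2`. -/
noncomputable def segCone (d : ℕ) : AddSubmonoid ℤ[X] :=
  AddSubmonoid.closure {p | ∃ i a, d + 1 ≤ 2 * i + a ∧ p = seg i a}

/-- The cone generated by pairs consisting of a segment with midpoint at least `d / 2` and a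
proper initial part of it. -/
noncomputable def segPairCone (d : ℕ) : AddSubmonoid (ℤ[X] × ℤ[X]) :=
  AddSubmonoid.closure {p | ∃ i a a', a' < a ∧ d + 1 ≤ 2 * i + a ∧ p = (seg i a, seg i a')}

theorem seg_mem_segCone {d i a : ℕ} (h : d + 1 ≤ 2 * i + a) : seg i a ∈ segCone d :=
  AddSubmonoid.subset_closure ⟨i, a, h, rfl⟩

theorem seg_mem_segPairCone {d i a a' : ℕ} (ha : a' < a) (h : d + 1 ≤ 2 * i + a) :
    (seg i a, seg i a') ∈ segPairCone d :=
  AddSubmonoid.subset_closure ⟨i, a, a', ha, h, rfl⟩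

theorem segCone_anti {d d' : ℕ} (h : d ≤ d') : segCone d' ≤ segCone d := by
  refine AddSubmonoid.closure_mono ?_
  rintro p ⟨i, a, hd, rfl⟩
  exact ⟨i, a, by omega, rfl⟩

theorem X_mul_mem_segCone {d : ℕ} {p : ℤ[X]} (hp : p ∈ segCone d) :
    X * p ∈ segCone (d + 2) := by
  induction hp using AddSubmonoid.closure_induction with
  | mem p hp =>
    obtain ⟨i, a, hd, rfl⟩ := hp
    rw [X_mul_seg]
    exact seg_mem_segCone (by omega)
  | zero => simp
  | add p q _ _ hp hq => rw [mul_add]; exact add_mem hp hq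

theorem prod_zero_mem_segPairCone {d : ℕ} {p : ℤ[X]} (hp : p ∈ segCone d) :
    (p, 0) ∈ segPairCone d := by
  induction hp using AddSubmonoid.closure_induction with
  | mem p hp =>
    obtain ⟨i, a, hd, rfl⟩ := hp
    rcases Nat.eq_zero_or_pos a with rfl | ha
    · rw [seg_zero]; exact zero_mem _
    · rw [← seg_zero i]; exact seg_mem_segPairCone ha hd
  | zero => exact zero_mem _
  | add p q _ _ hp hq => simpa using add_mem hp hq

theorem fst_mem_segCone {d : ℕ} {p : ℤ[X] × ℤ[X]} (hp : p ∈ segPairCone d) :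
    p.1 ∈ segCone d := by
  induction hp using AddSubmonoid.closure_induction with
  | mem p hp =>
    obtain ⟨i, a, a', ha, hd, rfl⟩ := hp
    exact seg_mem_segCone hd
  | zero => exact zero_mem _
  | add p q _ _ hp hq => exact add_mem hp hq

theorem seg_sub_seg {i a a' : ℕ} (h : a' ≤ a) : seg i a - seg i a' = seg (i + a') (a - a') := by
  ext k
  simp only [coeff_sub, coeff_seg]
  split_ifs <;> first | rfl | omega

theorem fst_sub_snd_mem_segCone {d : ℕ} {p : ℤ[X] × ℤ[X]} (hp : p ∈ segPairCone d) :
    p.1 - p.2 ∈ segCone d := by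
  induction hp using AddSubmonoid.closure_induction with
  | mem p hp =>
    obtain ⟨i, a, a', ha, hd, rfl⟩ := hp
    simp only [seg_sub_seg ha.le]
    exact seg_mem_segCone (by omega)
  | zero => simp
  | add p q _ _ hp hq =>
    have : (p + q).1 - (p + q).2 = (p.1 - p.2) + (q.1 - q.2) := by
      simp only [Prod.fst_add, Prod.snd_add]; ring
    rw [this]; exact add_mem hp hq

theorem seg_mul_seg_mem_segPairCone {d : ℕ} (a b a' b' i j : ℕ) (ha : a' < a) (hb : b' < b)
    (hd : d + 2 ≤ 2 * (i + j) + a + b) :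
    (seg i a * seg j b, seg i a' * seg j b') ∈ segPairCone d := by
  induction a generalizing b a' b' i with
  | zero => omega
  | succ a ih =>
    obtain ⟨b, rfl⟩ : ∃ c, b = c + 1 := ⟨b - 1, by omega⟩
    have hfst : ∀ (a b i : ℕ), d + 2 ≤ 2 * (i + j) + a + b →
        seg i a * seg j b ∈ segCone d := by
      intro a
      induction a with
      | zero => intro b i _; rw [seg_zero, zero_mul]; exact zero_mem _
      | succ a ih =>
        intro b i h
        rcases b with _ | b
        · rw [seg_zero, mul_zero]; exact zero_mem _
        rw [seg_mul_seg_succ, ← mul_assoc, X_mul_seg]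
        exact add_mem (seg_mem_segCone (by omega)) (ih b (i + 1) (by omega))
    rcases a' with _ | a'
    · rw [seg_zero, zero_mul]
      exact prod_zero_mem_segPairCone (hfst _ _ _ hd)
    rcases b' with _ | b'
    · rw [seg_zero, mul_zero]
      exact prod_zero_mem_segPairCone (hfst _ _ _ hd)
    rw [seg_mul_seg_succ, seg_mul_seg_succ, ← mul_assoc, ← mul_assoc, X_mul_seg, X_mul_seg]
    rw [← Prod.mk_add_mk]
    exact add_mem (seg_mem_segPairCone (by omega) (by omega))
      (ih b a' b' (i + 1) (by omega) (by omega) (by omega))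

theorem mul_mem_segPairCone {d d' : ℕ} {p q : ℤ[X] × ℤ[X]} (hp : p ∈ segPairCone d)
    (hq : q ∈ segPairCone d') : p * q ∈ segPairCone (d + d') := by
  induction hp using AddSubmonoid.closure_induction with
  | mem p hp =>
    obtain ⟨i, a, a', ha, hd, rfl⟩ := hp
    induction hq using AddSubmonoid.closure_induction with
    | mem q hq =>
      obtain ⟨j, b, b', hb, hd', rfl⟩ := hq
      rw [Prod.mk_mul_mk]
      exact seg_mul_seg_mem_segPairCone a b a' b' i j ha hb (by omega)
    | zero => rw [mul_zero]; exact zero_mem _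
    | add p q _ _ hp hq => rw [mul_add]; exact add_mem hp hq
  | zero => rw [zero_mul]; exact zero_mem _
  | add p q _ _ hp hq => rw [add_mul]; exact add_mem hp hq

theorem mul_mem_segCone {d d' : ℕ} {p q : ℤ[X]} (hp : p ∈ segCone d) (hq : q ∈ segCone d') :
    p * q ∈ segCone (d + d') :=
  fst_mem_segCone
    (mul_mem_segPairCone (prod_zero_mem_segPairCone hp) (prod_zero_mem_segPairCone hq))

theorem coeff_nonneg_of_mem_segCone {d : ℕ} {p : ℤ[X]} (hp : p ∈ segCone d) (k : ℕ) :
    0 ≤ p.coeff k := by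
  induction hp using AddSubmonoid.closure_induction with
  | mem p hp =>
    obtain ⟨i, a, hd, rfl⟩ := hp
    rw [coeff_seg]; split_ifs <;> simp
  | zero => simp
  | add p q _ _ hp hq => rw [coeff_add]; exact add_nonneg hp hq

theorem coeff_le_coeff_succ_of_mem_segCone {d : ℕ} {p : ℤ[X]} (hp : p ∈ segCone d) {k : ℕ}
    (hk : 2 * k + 2 ≤ d) : p.coeff k ≤ p.coeff (k + 1) := by
  induction hp using AddSubmonoid.closure_induction with
  | mem p hp =>
    obtain ⟨i, a, hd, rfl⟩ := hp
    simp only [coeff_seg]; split_ifs <;> omega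
  | zero => simp
  | add p q _ _ hp hq => simp only [coeff_add]; exact add_le_add hp hq

theorem coeff_le_coeff_sub_of_mem_segCone {d : ℕ} {p : ℤ[X]} (hp : p ∈ segCone d) {k : ℕ}
    (hk : 2 * k ≤ d) : p.coeff k ≤ p.coeff (d - k) := by
  induction hp using AddSubmonoid.closure_induction with
  | mem p hp =>
    obtain ⟨i, a, hd, rfl⟩ := hp
    simp only [coeff_seg]; split_ifs <;> omega
  | zero => simp
  | add p q _ _ hp hq => simp only [coeff_add]; exact add_le_add hp hq

theorem seg_sub_X_mul_seg {i a a' : ℕ} (h : a' < a) :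
    seg i a - X * seg i a' = X ^ i + seg (i + a' + 1) (a - a' - 1) := by
  rw [X_mul_seg]
  ext k
  simp only [coeff_sub, coeff_add, coeff_seg, coeff_X_pow]
  split_ifs <;> first | rfl | omega

theorem coeff_fst_sub_X_mul_snd_nonneg {d : ℕ} {p : ℤ[X] × ℤ[X]} (hp : p ∈ segPairCone d)
    (k : ℕ) : 0 ≤ (p.1 - X * p.2).coeff k := by
  induction hp using AddSubmonoid.closure_induction with
  | mem p hp =>
    obtain ⟨i, a, a', ha, hd, rfl⟩ := hp
    simp only [seg_sub_X_mul_seg ha, coeff_add, coeff_seg, coeff_X_pow]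
    split_ifs <;> simp
  | zero => simp
  | add p q _ _ hp hq =>
    have : (p + q).1 - X * (p + q).2 = (p.1 - X * p.2) + (q.1 - X * q.2) := by
      simp only [Prod.fst_add, Prod.snd_add]; ring
    rw [this, coeff_add]; exact add_nonneg hp hq

theorem coeff_seg_mul_seg_le {i j a b a' b' k n : ℕ} (ha : a' < a) (hb : b' < b)
    (hkn : k + 2 ≤ n) (h : k + n + 2 ≤ 2 * i + a + (2 * j + b)) :
    (seg (i + a') (a - a') * seg (j + b') (b - b')).coeff k ≤
      ((X ^ i + seg (i + a' + 1) (a - a' - 1)) *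
        (X ^ j + seg (j + b' + 1) (b - b' - 1))).coeff n := by
  rw [coeff_mul, coeff_mul, Finset.Nat.sum_antidiagonal_eq_sum_range_succ_mk,
    Finset.Nat.sum_antidiagonal_eq_sum_range_succ_mk]
  have e1 : ∀ x ∈ Finset.range (k + 1), (seg (i + a') (a - a')).coeff x *
      (seg (j + b') (b - b')).coeff (k - x) =
      if (i + a' ≤ x ∧ x < i + a) ∧ (j + b' ≤ k - x ∧ k - x < j + b) then 1 else 0 := by
    intro x _
    simp only [coeff_seg]
    split_ifs <;> first | rfl | omega
  have e2 : ∀ x ∈ Finset.range (n + 1), (X ^ i + seg (i + a' + 1) (a - a' - 1)).coeff x *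
      (X ^ j + seg (j + b' + 1) (b - b' - 1)).coeff (n - x) =
      if (x = i ∨ i + a' + 1 ≤ x ∧ x < i + a) ∧
        (n - x = j ∨ j + b' + 1 ≤ n - x ∧ n - x < j + b) then 1 else 0 := by
    intro x _
    simp only [coeff_add, coeff_X_pow, coeff_seg]
    split_ifs <;> first | rfl | omega
  rw [Finset.sum_congr rfl e1, Finset.sum_congr rfl e2, ← Finset.sum_filter,
    ← Finset.sum_filter, Finset.sum_const, Finset.sum_const, nsmul_one, nsmul_one, Nat.cast_le]
  let f : ℕ → ℕ := fun u ↦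
    if n ≤ i + j + a' + b then if u + 1 < i + a then u + 1 else i
    else if n ≤ i + j + a + b' then if k - u + 1 < j + b then n - (k - u + 1) else n - j
    else u + 1 + (n - (i + j + a' + b))
  refine Finset.card_le_card_of_injOn f ?_ ?_
  · intro u hu
    simp only [Finset.coe_filter, Finset.mem_range, Set.mem_ofPred_eq, f] at hu ⊢
    split_ifs <;> omega
  · intro u hu v hv huv
    simp only [Finset.coe_filter, Finset.mem_range, Set.mem_ofPred_eq, f] at hu hv huv
    split_ifs at huv <;> omega

theorem coeff_mul_le_of_mem_segPairCone {d d' k n : ℕ} {p q : ℤ[X] × ℤ[X]}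
    (hp : p ∈ segPairCone d) (hq : q ∈ segPairCone d') (hkn : k + 2 ≤ n) (h : k + n ≤ d + d') :
    ((p.1 - p.2) * (q.1 - q.2)).coeff k ≤ ((p.1 - X * p.2) * (q.1 - X * q.2)).coeff n := by
  induction hp using AddSubmonoid.closure_induction with
  | mem p hp =>
    obtain ⟨i, a, a', ha, hd, rfl⟩ := hp
    induction hq using AddSubmonoid.closure_induction with
    | mem q hq =>
      obtain ⟨j, b, b', hb, hd', rfl⟩ := hq
      simp only [seg_sub_seg ha.le, seg_sub_seg hb.le, seg_sub_X_mul_seg ha, seg_sub_X_mul_seg hb]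
      exact coeff_seg_mul_seg_le ha hb hkn (by omega)
    | zero => simp
    | add p q _ _ hp hq =>
      simp only [Prod.fst_add, Prod.snd_add] at hp hq ⊢
      rw [add_sub_add_comm, mul_add, mul_add X, add_sub_add_comm, mul_add, coeff_add, coeff_add]
      exact add_le_add hp hq
  | zero => simp
  | add p q _ _ hp hq =>
    simp only [Prod.fst_add, Prod.snd_add] at hp hq ⊢
    rw [add_sub_add_comm, add_mul, mul_add X, add_sub_add_comm, add_mul, coeff_add, coeff_add]
    exact add_le_add hp hq

theorem eval_one_nonneg {p : ℤ[X]} (h : ∀ k, 0 ≤ p.coeff k) : 0 ≤ p.eval 1 := by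
  rw [eval_eq_sum_range]
  exact Finset.sum_nonneg fun k _ ↦ by simpa using h k

theorem eval_one_seg (i a : ℕ) : (seg i a).eval 1 = a := by
  simp [seg, eval_finsetSum]

theorem mem_segCone_of_coeff {d : ℕ} {p : ℤ[X]} (h : ∀ k, 0 ≤ p.coeff k)
    (h0 : ∀ k, 2 * k ≤ d → p.coeff k = 0) : p ∈ segCone d := by
  rw [p.as_sum_range_C_mul_X_pow]
  refine sum_mem fun k _ ↦ ?_
  by_cases hk : 2 * k ≤ d
  · rw [h0 k hk, C_0, zero_mul]; exact zero_mem _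
  · have : C (p.coeff k) * X ^ k = (p.coeff k).toNat • seg k 1 := by
      rw [seg_one, nsmul_eq_mul, ← Int.cast_natCast, Int.toNat_of_nonneg (h k)]
      simp
    rw [this]
    exact nsmul_mem (seg_mem_segCone (by omega)) _

theorem mem_segPairCone_of_coeff_of_low_eq_zero {d : ℕ} (N : ℕ) {B D : ℤ[X]}
    (hN : (B + D).eval 1 < N)
    (hB : ∀ k, 0 ≤ B.coeff k) (hD : ∀ k, 0 ≤ D.coeff k) (hD0 : ∀ k, 2 * k ≤ d → D.coeff k = 0)
    (hBmono : ∀ k, 2 * k + 3 ≤ d → B.coeff k ≤ B.coeff (k + 1))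
    (hBsymm : ∀ k, 2 * k + 1 ≤ d → B.coeff k ≤ B.coeff (d - 1 - k))
    (hA : ∀ k, B.coeff k ≤ D.coeff (k + 1) + B.coeff (k + 1)) :
    (D + B, B) ∈ segPairCone d := by
  induction N generalizing B D with
  | zero =>
    have := eval_one_nonneg hB
    have := eval_one_nonneg hD
    rw [eval_add] at hN
    push_cast at hN
    omega
  | succ N ih =>
    by_cases hB0 : B = 0
    · subst hB0
      rw [add_zero]
      exact prod_zero_mem_segPairCone (mem_segCone_of_coeff hD hD0)
    have hex : ∃ k, B.coeff k ≠ 0 := by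
      by_contra! h
      exact hB0 (by ext k; simpa using h k)
    classical
    obtain ⟨i, hi, hmin⟩ : ∃ i, B.coeff i ≠ 0 ∧ ∀ t < i, B.coeff t = 0 :=
      ⟨Nat.find hex, Nat.find_spec hex, fun t ht ↦ by simpa using Nat.find_min hex ht⟩
    have hex' : ∃ j, i ≤ j ∧ B.coeff (j + 1) = 0 :=
      ⟨max i B.natDegree, le_max_left _ _, coeff_eq_zero_of_natDegree_lt (by omega)⟩
    obtain ⟨j, hij, hj, hpos⟩ : ∃ j, i ≤ j ∧ B.coeff (j + 1) = 0 ∧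
        ∀ t, i ≤ t → t ≤ j → 1 ≤ B.coeff t := by
      refine ⟨Nat.find hex', (Nat.find_spec hex').1, (Nat.find_spec hex').2, fun t h1 h2 ↦ ?_⟩
      have : B.coeff t ≠ 0 := by
        rcases h1.eq_or_lt with rfl | h1
        · exact hi
        · have := Nat.find_min hex' (m := t - 1) (by omega)
          rw [Nat.sub_add_cancel (by omega)] at this
          exact fun h ↦ this ⟨by omega, h⟩
      have := hB t
      omega
    have hd : d ≤ i + j + 1 := by
      by_contra! hlt
      by_cases h3 : 2 * j + 3 ≤ d
      · have := hBmono j h3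
        have := hpos j hij le_rfl
        omega
      · have h1 := hBsymm (d - 2 - j) (by omega)
        have h2 := hpos (d - 2 - j) (by omega) (by omega)
        rw [show d - 1 - (d - 2 - j) = j + 1 by omega] at h1
        omega
    have hDj : 1 ≤ D.coeff (j + 1) := by
      have := hA j
      have := hpos j hij le_rfl
      omega
    have hcB : ∀ t, (B - seg i (j + 1 - i)).coeff t =
        B.coeff t - if i ≤ t ∧ t ≤ j then 1 else 0 := by
      intro t
      rw [coeff_sub, coeff_seg]
      congr 2
      simp only [eq_iff_iff]
      omega
    have hcD : ∀ t, (D - X ^ (j + 1)).coeff t = D.coeff t - if t = j + 1 then 1 else 0 := by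
      intro t
      rw [coeff_sub, coeff_X_pow]
    have key := ih (B := B - seg i (j + 1 - i)) (D := D - X ^ (j + 1)) ?_ ?_ ?_ ?_ ?_ ?_ ?_
    · have hgen : (seg i (j + 2 - i), seg i (j + 1 - i)) ∈ segPairCone d :=
        seg_mem_segPairCone (by omega) (by omega)
      have e : seg i (j + 2 - i) = seg i (j + 1 - i) + X ^ (j + 1) := by
        ext t
        simp only [coeff_add, coeff_seg, coeff_X_pow]
        split_ifs <;> first | rfl | omega
      have := add_mem key hgen
      rw [Prod.mk_add_mk, e] at this
      convert this using 2 <;> ring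
    · have e : eval 1 (B - seg i (j + 1 - i) + (D - X ^ (j + 1))) =
          eval 1 (B + D) - ((j + 1 - i : ℕ) + 1) := by
        simp only [eval_add, eval_sub, eval_one_seg, eval_pow, eval_X, one_pow]; ring
      rw [e]
      push_cast at hN ⊢
      omega
    · intro t
      have := hB t
      have := hpos t
      rw [hcB]; split_ifs <;> omega
    · intro t
      have := hD t
      rw [hcD]; split_ifs with h
      · subst h; omega
      · omega
    · intro t ht
      have := hD0 t ht
      rw [hcD, this]; split_ifs with h
      · subst h; omega
      · rfl
    · intro t ht
      have := hBmono t ht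
      have := hpos (t + 1)
      have := hmin t
      rw [hcB, hcB]; split_ifs <;> omega
    · intro t ht
      have := hBsymm t ht
      have := hpos (d - 1 - t)
      have := hmin t
      rw [hcB, hcB]; split_ifs <;> omega
    · intro t
      have := hA t
      have := hpos (t + 1)
      have := hmin t
      have := hD (t + 1)
      rw [hcB, hcB, hcD]; split_ifs <;> omega

theorem mem_segPairCone_of_coeff_aux {d : ℕ} (N : ℕ) {B D : ℤ[X]} (hN : D.eval 1 < N)
    (hB : ∀ k, 0 ≤ B.coeff k) (hD : ∀ k, 0 ≤ D.coeff k)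
    (hBmono : ∀ k, 2 * k + 3 ≤ d → B.coeff k ≤ B.coeff (k + 1))
    (hBsymm : ∀ k, 2 * k + 1 ≤ d → B.coeff k ≤ B.coeff (d - 1 - k))
    (hDmono : ∀ k, 2 * k + 2 ≤ d → D.coeff k ≤ D.coeff (k + 1))
    (hDsymm : ∀ k, 2 * k ≤ d → D.coeff k ≤ D.coeff (d - k))
    (hDA : ∀ k, 2 * k < d →
      D.coeff k + B.coeff (d - k - 1) ≤ D.coeff (d - k) + B.coeff (d - k))
    (hA : ∀ k, B.coeff k ≤ D.coeff (k + 1) + B.coeff (k + 1)) :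
    (D + B, B) ∈ segPairCone d := by
  induction N generalizing D with
  | zero =>
    have := eval_one_nonneg hD
    push_cast at hN
    omega
  | succ N ih =>
    by_cases hD0 : ∀ k, 2 * k ≤ d → D.coeff k = 0
    · exact mem_segPairCone_of_coeff_of_low_eq_zero ((B + D).eval 1 + 1).toNat
        (by have := eval_one_nonneg hB; have := eval_one_nonneg hD; rw [eval_add]; omega)
        hB hD hD0 hBmono hBsymm hA
    have hex : ∃ k, 2 * k ≤ d ∧ D.coeff k ≠ 0 := by simpa using hD0
    classical
    obtain ⟨i, hid, hi, hmin⟩ :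
        ∃ i, 2 * i ≤ d ∧ D.coeff i ≠ 0 ∧ ∀ t < i, D.coeff t = 0 := by
      refine ⟨Nat.find hex, (Nat.find_spec hex).1, (Nat.find_spec hex).2, fun t ht ↦ ?_⟩
      have h1 := Nat.find_min hex ht
      have h2 := (Nat.find_spec hex).1
      by_contra h3
      exact h1 ⟨by omega, h3⟩
    have hlow : ∀ s, 2 * (i + s) ≤ d → 1 ≤ D.coeff (i + s) := by
      intro s
      induction s with
      | zero => have := hD i; intro _; rw [add_zero]; omega
      | succ s ihs =>
        intro hs
        exact (ihs (by omega)).trans (hDmono (i + s) (by omega))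
    have hpos : ∀ t, i ≤ t → t ≤ d - i → 1 ≤ D.coeff t := by
      intro t h1 h2
      by_cases ht : 2 * t ≤ d
      · have := hlow (t - i) (by omega)
        rwa [Nat.add_sub_cancel' h1] at this
      · have h3 := hlow (d - t - i) (by omega)
        have h4 := hDsymm (d - t) (by omega)
        rw [show i + (d - t - i) = d - t by omega] at h3
        rw [show d - (d - t) = t by omega] at h4
        exact h3.trans h4
    have hc : ∀ t, (D - seg i (d + 1 - 2 * i)).coeff t =
        D.coeff t - if i ≤ t ∧ t ≤ d - i then 1 else 0 := by
      intro t
      rw [coeff_sub, coeff_seg]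
      congr 2
      simp only [eq_iff_iff]
      omega
    have key := ih (D := D - seg i (d + 1 - 2 * i)) ?_ ?_ ?_ ?_ ?_ ?_
    · have := add_mem key (prod_zero_mem_segPairCone
        (seg_mem_segCone (d := d) (i := i) (a := d + 1 - 2 * i) (by omega)))
      rw [Prod.mk_add_mk] at this
      convert this using 2 <;> ring
    · rw [eval_sub, eval_one_seg]
      push_cast at hN ⊢
      omega
    · intro t
      have := hD t
      have := hpos t
      rw [hc]; split_ifs <;> omega
    · intro t ht
      have := hDmono t ht
      have := hpos (t + 1)
      have := hmin t
      rw [hc, hc]; split_ifs <;> omega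
    · intro t ht
      have := hDsymm t ht
      rw [hc, hc]; split_ifs <;> omega
    · intro t ht
      have := hDA t ht
      rw [hc, hc]; split_ifs <;> omega
    · intro t
      have h1 := hA t
      rw [hc]; split_ifs with h
      · have h2 := hpos (t + 1) h.1 h.2
        by_cases h3 : 2 * (t + 1) < d
        · have := hBmono t (by omega)
          omega
        by_cases h4 : 2 * (t + 1) = d
        · have h5 := hBsymm t (by omega)
          rw [show d - 1 - t = t + 1 by omega] at h5
          omega
        · have h5 := hDA (d - (t + 1)) (by omega)
          have h6 := hpos (d - (t + 1)) (by omega) (by omega)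
          rw [show d - (d - (t + 1)) - 1 = t by omega,
            show d - (d - (t + 1)) = t + 1 by omega] at h5
          omega
      · omega

theorem mem_segPairCone_of_coeff {d : ℕ} {B D : ℤ[X]}
    (hB : ∀ k, 0 ≤ B.coeff k) (hD : ∀ k, 0 ≤ D.coeff k)
    (hBmono : ∀ k, 2 * k + 3 ≤ d → B.coeff k ≤ B.coeff (k + 1))
    (hBsymm : ∀ k, 2 * k + 1 ≤ d → B.coeff k ≤ B.coeff (d - 1 - k))
    (hDmono : ∀ k, 2 * k + 2 ≤ d → D.coeff k ≤ D.coeff (k + 1))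
    (hDsymm : ∀ k, 2 * k ≤ d → D.coeff k ≤ D.coeff (d - k))
    (hDA : ∀ k, 2 * k < d →
      D.coeff k + B.coeff (d - k - 1) ≤ D.coeff (d - k) + B.coeff (d - k))
    (hA : ∀ k, B.coeff k ≤ D.coeff (k + 1) + B.coeff (k + 1)) :
    (D + B, B) ∈ segPairCone d :=
  mem_segPairCone_of_coeff_aux (D.eval 1 + 1).toNat
    (by have := eval_one_nonneg hD; omega) hB hD hBmono hBsymm hDmono hDsymm hDA hA

theorem mem_segPairCone_of_mem_segCone {d : ℕ} {H B : ℤ[X]} (hd : 1 ≤ d)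
    (hB : B ∈ segCone (d - 1)) (hD : H - B ∈ segCone d)
    (hA : ∀ k, 0 ≤ (H - X * B).coeff k)
    (hDA : ∀ k, 2 * k < d → (H - B).coeff k ≤ (H - X * B).coeff (d - k)) :
    (H, B) ∈ segPairCone d := by
  have key := mem_segPairCone_of_coeff (d := d) (B := B) (D := H - B)
    (coeff_nonneg_of_mem_segCone hB) (coeff_nonneg_of_mem_segCone hD)
    (fun k hk ↦ coeff_le_coeff_succ_of_mem_segCone hB (by omega))
    (fun k hk ↦ coeff_le_coeff_sub_of_mem_segCone hB (by omega))
    (fun k hk ↦ coeff_le_coeff_succ_of_mem_segCone hD hk)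
    (fun k hk ↦ coeff_le_coeff_sub_of_mem_segCone hD hk) ?_ ?_
  · rwa [sub_add_cancel] at key
  · intro k hk
    have h := hDA k hk
    obtain ⟨m, hm⟩ : ∃ m, d - k = m + 1 := ⟨d - k - 1, by omega⟩
    rw [hm, coeff_sub H (X * B), coeff_X_mul] at h
    rw [hm, Nat.add_sub_cancel, coeff_sub H B (m + 1)]
    linarith
  · intro k
    have h := hA (k + 1)
    rw [coeff_sub, coeff_X_mul] at h
    rw [coeff_sub]
    linarith

/-- The axioms of a matroid rank function. -/
structure IsRk {α : Type*} [DecidableEq α] (r : Finset α → ℕ) : Prop where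
  empty : r ∅ = 0
  insert_le : ∀ e S, r (insert e S) ≤ r S + 1
  mono : ∀ {S T}, S ⊆ T → r S ≤ r T
  submod : ∀ S T, r (S ∪ T) + r (S ∩ T) ≤ r S + r T

/-- The rank function of the contraction by `N`. -/
def ctr {α : Type*} [DecidableEq α] (r : Finset α → ℕ) (N S : Finset α) : ℕ := r (N ∪ S) - r N

/-- The summand of `S` in the h-polynomial of a matroid of rank `n` with rank function `r`. -/
noncomputable def hTerm {α : Type*} (r : Finset α → ℕ) (n : ℕ) (S : Finset α) : ℤ[X] :=
  (-1) ^ S.card * (-X) ^ r S * (1 - X) ^ (n - r S)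

/-- The h-polynomial of the broken circuit complex of the matroid on `E` with rank function `r`. -/
noncomputable def hPoly {α : Type*} (r : Finset α → ℕ) (E : Finset α) : ℤ[X] :=
  ∑ S ∈ E.powerset, hTerm r (r E) S

theorem hPoly_congr {α : Type*} {r r' : Finset α → ℕ} {E : Finset α} (h : ∀ S ⊆ E, r S = r' S) :
    hPoly r E = hPoly r' E := by
  refine Finset.sum_congr rfl fun S hS ↦ ?_
  rw [hTerm, hTerm, h S (Finset.mem_powerset.1 hS), h E subset_rfl]

/-- Connectedness of the matroid on `E` with rank function `r`. -/
def Conn {α : Type*} [DecidableEq α] (r : Finset α → ℕ) (E : Finset α) : Prop :=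
  ∀ U N, Disjoint U N → U ∪ N = E → U.Nonempty → N.Nonempty → r E < r U + r N

section

variable {α : Type*} [DecidableEq α] {r : Finset α → ℕ}

theorem IsRk.submod_of_subset (hr : IsRk r) {S T I J : Finset α} (hJ : J ⊆ S ∪ T)
    (hI : I ⊆ S ∩ T) : r J + r I ≤ r S + r T :=
  (add_le_add (hr.mono hJ) (hr.mono hI)).trans (hr.submod S T)

theorem IsRk.union_le (hr : IsRk r) (S T : Finset α) : r (S ∪ T) ≤ r S + r T := by
  have := hr.submod S T
  omega

theorem IsRk.le_insert (hr : IsRk r) (e : α) (S : Finset α) : r S ≤ r (insert e S) :=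
  hr.mono (Finset.subset_insert e S)

theorem IsRk.singleton_le (hr : IsRk r) (e : α) : r {e} ≤ 1 := by
  have := hr.insert_le e ∅
  rwa [hr.empty] at this

theorem IsRk.ctr (hr : IsRk r) (N : Finset α) : IsRk (ctr r N) where
  empty := by simp [_root_.ctr]
  insert_le e S := by
    have := hr.insert_le e (N ∪ S)
    simp only [_root_.ctr, Finset.union_insert]
    omega
  mono h := Nat.sub_le_sub_right (hr.mono (Finset.union_subset_union_right h)) _
  submod S T := by
    have h1 := hr.submod (N ∪ S) (N ∪ T)
    have h2 := hr.mono (Finset.subset_union_left (s₁ := N) (s₂ := S))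
    have h3 := hr.mono (Finset.subset_union_left (s₁ := N) (s₂ := T))
    have h4 := hr.mono (Finset.subset_union_left (s₁ := N) (s₂ := S ∩ T))
    have h5 := hr.mono (Finset.subset_union_left (s₁ := N) (s₂ := S ∪ T))
    rw [← Finset.union_union_distrib_left, ← Finset.union_inter_distrib_left] at h1
    simp only [_root_.ctr]
    omega

theorem ctr_add (hr : IsRk r) (N S : Finset α) : ctr r N S + r N = r (N ∪ S) :=
  Nat.sub_add_cancel (hr.mono Finset.subset_union_left)

theorem ctr_singleton_add (hr : IsRk r) (e : α) (S : Finset α) :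
    ctr r {e} S + r {e} = r (insert e S) := ctr_add hr {e} S

theorem ctr_ctr (hr : IsRk r) (N P : Finset α) : ctr (ctr r N) P = ctr r (N ∪ P) := by
  funext S
  have h1 := ctr_add hr N (P ∪ S)
  have h2 := ctr_add hr N P
  have h3 := ctr_add hr (N ∪ P) S
  rw [Finset.union_assoc] at h3
  have h4 := ctr_add (hr.ctr N) P S
  omega

theorem sum_powerset_union {β : Type*} [AddCommMonoid β] {U N : Finset α} (h : Disjoint U N)
    (f : Finset α → β) :
    ∑ S ∈ (U ∪ N).powerset, f S = ∑ S ∈ U.powerset, ∑ T ∈ N.powerset, f (S ∪ T) := by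
  induction N using Finset.induction_on generalizing f with
  | empty => simp
  | insert a N ha ih =>
    rw [Finset.disjoint_insert_right] at h
    rw [Finset.union_insert, Finset.sum_powerset_insert (by simp [h.1, ha]), ih h.2, ih h.2,
      ← Finset.sum_add_distrib]
    refine Finset.sum_congr rfl fun S _ ↦ ?_
    rw [Finset.sum_powerset_insert ha]
    simp only [Finset.union_insert]

theorem sum_powerset_union_mul {U N : Finset α} (h : Disjoint U N) {f g k : Finset α → ℤ[X]}
    (hf : ∀ S ⊆ U, ∀ T ⊆ N, f (S ∪ T) = g S * k T) :
    ∑ S ∈ (U ∪ N).powerset, f S = (∑ S ∈ U.powerset, g S) * ∑ T ∈ N.powerset, k T := by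
  rw [sum_powerset_union h, Finset.sum_mul_sum]
  exact Finset.sum_congr rfl fun S hS ↦ Finset.sum_congr rfl fun T hT ↦
    hf S (Finset.mem_powerset.1 hS) T (Finset.mem_powerset.1 hT)

theorem hTerm_mul {r₁ r₂ : Finset α → ℕ} {S T : Finset α} {n n₁ n₂ : ℕ} (hST : Disjoint S T)
    (h1 : r₁ S ≤ n₁) (h2 : r₂ T ≤ n₂) (h : r (S ∪ T) = r₁ S + r₂ T) (hn : n = n₁ + n₂) :
    hTerm r n (S ∪ T) = hTerm r₁ n₁ S * hTerm r₂ n₂ T := by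
  rw [hTerm, hTerm, hTerm, h, Finset.card_union_of_disjoint hST, hn,
    show n₁ + n₂ - (r₁ S + r₂ T) = (n₁ - r₁ S) + (n₂ - r₂ T) by omega]
  ring

/-- In a direct sum the rank is additive. -/
theorem rk_union_of_le (hr : IsRk r) {U N S T : Finset α}
    (h : r U + r N ≤ r (U ∪ N)) (hS : S ⊆ U) (hT : T ⊆ N) : r (S ∪ T) = r S + r T := by
  have h1 := hr.submod_of_subset (S := U) (T := S ∪ N) (J := U ∪ N) (I := S)
    (by grind) (by grind)
  have h2 := hr.submod_of_subset (S := S ∪ T) (T := N) (J := S ∪ N) (I := T)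
    (by grind) (by grind)
  have h3 := hr.union_le S T
  omega

theorem hPoly_union (hr : IsRk r) {U N : Finset α} (hd : Disjoint U N)
    (h : r U + r N ≤ r (U ∪ N)) : hPoly r (U ∪ N) = hPoly r U * hPoly r N := by
  refine sum_powerset_union_mul hd fun S hS T hT ↦ ?_
  exact hTerm_mul (Finset.disjoint_of_subset_left hS (Finset.disjoint_of_subset_right hT hd))
    (hr.mono hS) (hr.mono hT) (rk_union_of_le hr h hS hT)
    (rk_union_of_le hr h subset_rfl subset_rfl)

theorem hPoly_empty (hr : IsRk r) : hPoly r ∅ = 1 := by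
  simp [hPoly, hTerm, hr.empty]

theorem hPoly_insert_eq_sum (r : Finset α → ℕ) {e : α} {E : Finset α} (he : e ∉ E) :
    hPoly r (insert e E) = ∑ S ∈ E.powerset,
      (hTerm r (r (insert e E)) S + hTerm r (r (insert e E)) (insert e S)) := by
  rw [hPoly, Finset.sum_powerset_insert he, Finset.sum_add_distrib]

theorem hPoly_insert_of_loop (hr : IsRk r) {e : α} {E : Finset α} (he : e ∉ E)
    (hl : r {e} = 0) : hPoly r (insert e E) = 0 := by
  rw [hPoly_insert_eq_sum r he]
  refine Finset.sum_eq_zero fun S hS ↦ ?_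
  have hS' : e ∉ S := fun h ↦ he (Finset.mem_powerset.1 hS h)
  have h1 : r (insert e S) = r S := by
    have := hr.union_le {e} S
    have := hr.le_insert e S
    rw [← Finset.insert_eq] at *
    omega
  rw [hTerm, hTerm, h1, Finset.card_insert_of_notMem hS']
  ring

theorem hTerm_insert (hr : IsRk r) {e : α} {S : Finset α} (n : ℕ) (he : e ∉ S)
    (hl : r {e} = 1) : hTerm r (n + 1) (insert e S) = X * hTerm (ctr r {e}) n S := by
  have h1 := ctr_singleton_add hr e S
  rw [hTerm, hTerm, ← h1, hl, Finset.card_insert_of_notMem he, Nat.add_sub_add_right]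
  ring

/-- Deletion-contraction. -/
theorem hPoly_insert (hr : IsRk r) {e : α} {E : Finset α} (he : e ∉ E)
    (hl : r {e} = 1) (hc : r (insert e E) = r E) :
    hPoly r (insert e E) = hPoly r E + X * hPoly (ctr r {e}) E := by
  rw [hPoly, Finset.sum_powerset_insert he, hc, hPoly, hPoly, Finset.mul_sum]
  congr 1
  refine Finset.sum_congr rfl fun S hS ↦ ?_
  have h1 := ctr_singleton_add hr e E
  rw [← hTerm_insert hr _ (fun h ↦ he (Finset.mem_powerset.1 hS h)) hl, ← hc, ← h1, hl]

theorem X_mul_hPoly_insert_sub (hr : IsRk r) {e : α} {E : Finset α} (he : e ∉ E)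
    (hl : r {e} = 1) (hc : r (insert e E) = r E) :
    X * (hPoly r (insert e E) - hPoly (ctr r {e}) E) =
      ∑ S ∈ E.powerset, (X * hTerm r (r E) S - (1 - X) * hTerm r (r E) (insert e S)) := by
  have h1 : X * hPoly (ctr r {e}) E = ∑ S ∈ E.powerset, hTerm r (r E) (insert e S) := by
    rw [hPoly, Finset.mul_sum]
    refine Finset.sum_congr rfl fun S hS ↦ ?_
    have h1 := ctr_singleton_add hr e E
    rw [← hTerm_insert hr _ (fun h ↦ he (Finset.mem_powerset.1 hS h)) hl, ← hc, ← h1, hl]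
  rw [Finset.sum_sub_distrib, ← Finset.mul_sum, ← Finset.mul_sum, ← h1,
    hPoly_insert hr he hl hc]
  have h2 : hPoly r E = ∑ S ∈ E.powerset, hTerm r (r E) S := rfl
  rw [← h2]
  ring

/-- The summands of `hPoly_insert_eq_sum`. -/
theorem hTerm_add_hTerm_insert {e : α} {S : Finset α} {n : ℕ} (he : e ∉ S)
    (hS : r (insert e S) ≤ n) (h : r S ≤ r (insert e S)) (h' : r (insert e S) ≤ r S + 1) :
    hTerm r n S + hTerm r n (insert e S) = if r (insert e S) = r S then 0 else
      (-1) ^ S.card * (-X) ^ r S * (1 - X) ^ (n - 1 - r S) := by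
  rw [hTerm, hTerm, Finset.card_insert_of_notMem he]
  split_ifs with h1
  · rw [h1]; ring
  · have h2 : r (insert e S) = r S + 1 := by omega
    obtain ⟨m, rfl⟩ : ∃ m, n = r S + 1 + m := ⟨n - (r S + 1), by omega⟩
    rw [h2, show r S + 1 + m - r S = m + 1 by omega, show r S + 1 + m - (r S + 1) = m by omega,
      show r S + 1 + m - 1 - r S = m by omega]
    ring

/-- The summands of `X_mul_hPoly_insert_sub`. -/
theorem X_mul_hTerm_sub {e : α} {S : Finset α} {n : ℕ} (he : e ∉ S)
    (hS : r (insert e S) ≤ n) (h : r S ≤ r (insert e S)) (h' : r (insert e S) ≤ r S + 1) :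
    X * hTerm r n S - (1 - X) * hTerm r n (insert e S) =
      if r (insert e S) = r S then hTerm r n S else 0 := by
  rw [hTerm, hTerm, Finset.card_insert_of_notMem he]
  split_ifs with h1
  · rw [h1]; ring
  · have h2 : r (insert e S) = r S + 1 := by omega
    obtain ⟨m, rfl⟩ : ∃ m, n = r S + 1 + m := ⟨n - (r S + 1), by omega⟩
    rw [h2, show r S + 1 + m - r S = m + 1 by omega, show r S + 1 + m - (r S + 1) = m by omega]
    ring

end

section

variable {α : Type*} [DecidableEq α] {r : Finset α → ℕ}

/-- The h-polynomial of a parallel connection at the base point. -/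
theorem hPoly_insert_union (hr : IsRk r) {e : α} {U N : Finset α} (hd : Disjoint U N)
    (hU : e ∉ U) (hN : e ∉ N) (hl : r {e} = 1)
    (h : r (insert e U) + r (insert e N) ≤ r (insert e (U ∪ N)) + 1) :
    hPoly r (insert e (U ∪ N)) = hPoly r (insert e U) * hPoly r (insert e N) := by
  have hc : ∀ S, ctr r {e} S + 1 = r (insert e S) := fun S ↦ hl ▸ ctr_singleton_add hr e S
  have h' : ctr r {e} U + ctr r {e} N ≤ ctr r {e} (U ∪ N) := by
    have := hc U; have := hc N; have := hc (U ∪ N)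
    omega
  rw [hPoly_insert_eq_sum r (by simp [hU, hN]), hPoly_insert_eq_sum r hU,
    hPoly_insert_eq_sum r hN]
  refine sum_powerset_union_mul hd fun S hS T hT ↦ ?_
  have key : ∀ {S' T' : Finset α}, S' ⊆ U → T' ⊆ N →
      r (insert e (S' ∪ T')) + 1 = r (insert e S') + r (insert e T') := by
    intro S' T' hS hT
    have := rk_union_of_le (hr.ctr {e}) h' hS hT
    have := hc S'; have := hc T'; have := hc (S' ∪ T')
    omega
  have k1 := key hS hT
  have k2 := key (subset_refl U) (subset_refl N)
  have b1 := hr.le_insert e S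
  have b2 := hr.le_insert e T
  have b3 := hr.le_insert e (S ∪ T)
  have c1 := hr.insert_le e S
  have c2 := hr.insert_le e T
  have c3 := hr.insert_le e (S ∪ T)
  have d1 := hr.mono (Finset.insert_subset_insert e hS)
  have d2 := hr.mono (Finset.insert_subset_insert e hT)
  have d3 := hr.mono (Finset.insert_subset_insert e (Finset.union_subset_union hS hT))
  have u := hr.union_le S T
  have v1 := hr.submod_of_subset (S := insert e S) (T := S ∪ T) (J := insert e (S ∪ T)) (I := S)
    (by grind) (by grind)
  have v2 := hr.submod_of_subset (S := insert e T) (T := S ∪ T) (J := insert e (S ∪ T)) (I := T)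
    (by grind) (by grind)
  have p1 := hc S
  have p2 := hc T
  rw [hTerm_add_hTerm_insert (by grind) d3 b3 c3, hTerm_add_hTerm_insert (by grind) d1 b1 c1,
    hTerm_add_hTerm_insert (by grind) d2 b2 c2]
  by_cases h1 : r (insert e S) = r S
  · rw [if_pos h1, if_pos (by omega), zero_mul]
  by_cases h2 : r (insert e T) = r T
  · rw [if_pos h2, if_pos (by omega), mul_zero]
  rw [if_neg h1, if_neg h2, if_neg (by omega),
    Finset.card_union_of_disjoint
      (Finset.disjoint_of_subset_left hS (Finset.disjoint_of_subset_right hT hd)),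
    show r (S ∪ T) = r S + r T by omega,
    show r (insert e (U ∪ N)) - 1 - (r S + r T) =
      (r (insert e U) - 1 - r S) + (r (insert e N) - 1 - r T) by omega]
  ring

/-- The h-polynomial of a series connection at the base point. -/
theorem hPoly_sub_hPoly_series (hr : IsRk r) {e : α} {U N : Finset α} (hd : Disjoint U N)
    (hU : e ∉ U) (hN : e ∉ N) (h : r U + r N ≤ r (U ∪ N)) (hc : r (insert e (U ∪ N)) = r (U ∪ N))
    (heU : r (insert e U) = r U + 1) (heN : r (insert e N) = r N + 1) :
    hPoly r (insert e (U ∪ N)) - hPoly (ctr r {e}) (U ∪ N) =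
      X * ((hPoly (ctr r N) (insert e U) - hPoly (ctr (ctr r N) {e}) U) *
        (hPoly (ctr r U) (insert e N) - hPoly (ctr (ctr r U) {e}) N)) := by
  have hUN := rk_union_of_le hr h subset_rfl subset_rfl
  have hl : r {e} = 1 := by
    have h1 := hr.union_le {e} U
    rw [← Finset.insert_eq] at h1
    have := hr.singleton_le e
    omega
  have cN := ctr_add hr N
  have cU := ctr_add hr U
  have i1 : r (N ∪ insert e U) = r (insert e (U ∪ N)) := by congr 1; grind
  have i2 : r (U ∪ insert e N) = r (insert e (U ∪ N)) := by congr 1; grind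
  have i3 : r (N ∪ {e}) = r (insert e N) := by congr 1; grind
  have i4 : r (U ∪ {e}) = r (insert e U) := by congr 1; grind
  have i5 : r (N ∪ U) = r (U ∪ N) := by congr 1; grind
  have cN1 := cN (insert e U)
  have cN2 := cN {e}
  have cN3 := cN U
  have cU1 := cU (insert e N)
  have cU2 := cU {e}
  have cU3 := cU N
  have hX : (X : ℤ[X]) ≠ 0 := X_ne_zero
  refine mul_left_cancel₀ hX ?_
  rw [X_mul_hPoly_insert_sub hr (by simp [hU, hN]) hl hc]
  have e1 := X_mul_hPoly_insert_sub (hr.ctr N) hU (by omega) (by omega)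
  have e2 := X_mul_hPoly_insert_sub (hr.ctr U) hN (by omega) (by omega)
  rw [show ∀ p q : ℤ[X], X * (X * (p * q)) = (X * p) * (X * q) by intros; ring, e1, e2]
  refine sum_powerset_union_mul hd fun S hS T hT ↦ ?_
  have hN' := hr.ctr N
  have hU' := hr.ctr U
  rw [X_mul_hTerm_sub (by grind), X_mul_hTerm_sub (by grind), X_mul_hTerm_sub (by grind)]
  rotate_left
  · have := hU'.mono (Finset.insert_subset_insert e hT)
    omega
  · exact hU'.le_insert _ _
  · exact hU'.insert_le _ _
  · have := hN'.mono (Finset.insert_subset_insert e hS)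
    omega
  · exact hN'.le_insert _ _
  · exact hN'.insert_le _ _
  · exact hc ▸ hr.mono (Finset.insert_subset_insert e (Finset.union_subset_union hS hT))
  · exact hr.le_insert _ _
  · exact hr.insert_le _ _
  have k1 := rk_union_of_le hr h hS hT
  have k2 : ctr r N S = r S := by
    have := rk_union_of_le hr h hS (subset_refl N)
    rw [Finset.union_comm] at this
    have := cN S
    omega
  have k3 : ctr r U T = r T := by
    have := rk_union_of_le hr h (subset_refl U) hT
    have := cU T
    omega
  have l1 : ctr r N (insert e S) ≤ r (insert e (S ∪ T)) - r T := by
    have := hr.submod_of_subset (S := N) (T := insert e (S ∪ T)) (J := N ∪ insert e S)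
      (I := T) (by grind) (by grind)
    have := cN (insert e S)
    omega
  have l2 : ctr r U (insert e T) ≤ r (insert e (S ∪ T)) - r S := by
    have := hr.submod_of_subset (S := U) (T := insert e (S ∪ T)) (J := U ∪ insert e T)
      (I := S) (by grind) (by grind)
    have := cU (insert e T)
    omega
  have l3 : r (insert e (S ∪ T)) ≤ ctr r N (insert e S) + ctr r U (insert e T) := by
    have := hr.submod_of_subset (S := N ∪ insert e S) (T := U ∪ insert e T)
      (J := insert e (U ∪ N)) (I := insert e (S ∪ T)) (by grind) (by grind)
    have := cN (insert e S)
    have := cU (insert e T)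
    omega
  have b1 := hN'.le_insert e S
  have b2 := hU'.le_insert e T
  have b3 := hr.le_insert e (S ∪ T)
  have m1 := hr.mono hS
  have m2 := hr.mono hT
  have n1 : ctr r N (insert e U) = r U := by omega
  have n2 : ctr r U (insert e N) = r N := by omega
  have n3 : ctr r N U = r U := by omega
  have n4 : ctr r U N = r N := by omega
  clear cN1 cN2 cN3 cU1 cU2 cU3 i1 i2 i3 i4 i5 heU heN h e1 e2 hl hc cN cU
  by_cases h1 : ctr r N (insert e S) = ctr r N S
  · by_cases h2 : ctr r U (insert e T) = ctr r U T
    · rw [if_pos h1, if_pos h2, if_pos (by omega)]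
      exact hTerm_mul (Finset.disjoint_of_subset_left hS (Finset.disjoint_of_subset_right hT hd))
        (by omega) (by omega) (by omega) (by omega)
    · rw [if_neg h2, if_neg (by omega), mul_zero]
  · rw [if_neg h1, if_neg (by omega), zero_mul]

/-- The h-polynomial of a matroid with a 2-separation. -/
theorem hPoly_union_of_two_sep (hr : IsRk r) {U N : Finset α} (hd : Disjoint U N)
    (h : r U + r N = r (U ∪ N) + 1) :
    hPoly r (U ∪ N) = hPoly r U * (hPoly r N + X * hPoly (ctr r U) N) +
      X * hPoly (ctr r N) U * (hPoly r N + X * hPoly (ctr r U) N - hPoly (ctr r U) N) := by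
  have hsum : hPoly r U * (hPoly r N + X * hPoly (ctr r U) N) +
      X * hPoly (ctr r N) U * (hPoly r N + X * hPoly (ctr r U) N - hPoly (ctr r U) N) =
      hPoly r U * hPoly r N + X * (hPoly r U * hPoly (ctr r U) N) +
      X * (hPoly (ctr r N) U * hPoly r N) + (X ^ 2 - X) *
        (hPoly (ctr r N) U * hPoly (ctr r U) N) := by ring
  rw [hsum]
  simp only [hPoly]
  rw [sum_powerset_union hd]
  simp only [Finset.sum_mul_sum]
  simp only [Finset.mul_sum, ← Finset.sum_add_distrib]
  refine Finset.sum_congr rfl fun S hS ↦ Finset.sum_congr rfl fun T hT ↦ ?_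
  rw [Finset.mem_powerset] at hS hT
  have cN := ctr_add hr N
  have cU := ctr_add hr U
  have i5 : r (N ∪ U) = r (U ∪ N) := by congr 1; grind
  have q1 := cN S
  have q2 := cU T
  have q3 := cN U
  have q4 := cU N
  have v1 := hr.submod_of_subset (S := S ∪ T) (T := N) (J := N ∪ S) (I := T)
    (by grind) (by grind)
  have v2 := hr.submod_of_subset (S := S ∪ T) (T := U) (J := U ∪ T) (I := S)
    (by grind) (by grind)
  have v3 := hr.submod_of_subset (S := N ∪ S) (T := U ∪ T) (J := U ∪ N) (I := S ∪ T)
    (by grind) (by grind)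
  have v4 := hr.submod_of_subset (S := N ∪ S) (T := U) (J := U ∪ N) (I := S)
    (by grind) (by grind)
  have v5 := hr.submod_of_subset (S := U ∪ T) (T := N) (J := U ∪ N) (I := T)
    (by grind) (by grind)
  have m1 := hr.mono hS
  have m2 := hr.mono hT
  have m3 := hr.mono (Finset.union_subset_union (subset_refl N) hS)
  have m4 := hr.mono (Finset.union_subset_union (subset_refl U) hT)
  have u := hr.union_le S T
  have u1 := hr.union_le N S
  have u2 := hr.union_le U T
  have hcard : (S ∪ T).card = S.card + T.card := Finset.card_union_of_disjoint
    (Finset.disjoint_of_subset_left hS (Finset.disjoint_of_subset_right hT hd))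
  simp only [hTerm, hcard]
  generalize ctr r N S = cS at *
  generalize ctr r U T = cT at *
  generalize ctr r N U = cNU at *
  generalize ctr r U N = cUN at *
  generalize r S = rS at *
  generalize r T = rT at *
  generalize r (S ∪ T) = rST at *
  generalize r (U ∪ N) = n at *
  generalize r U = rU at *
  generalize r N = rN at *
  obtain rfl : rU = cNU + 1 := by omega
  obtain rfl : rN = cUN + 1 := by omega
  obtain h1 | h1 : rS = cS ∨ rS = cS + 1 := by omega
  · obtain ⟨a, rfl⟩ : ∃ a, cNU = cS + a := ⟨cNU - cS, by omega⟩
    obtain h2 | h2 : rT = cT ∨ rT = cT + 1 := by omega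
    · obtain ⟨b, rfl⟩ : ∃ b, cUN = cT + b := ⟨cUN - cT, by omega⟩
      obtain rfl : rST = cS + cT := by omega
      subst h1 h2
      rw [show n - (rS + rT) = a + b + 1 by omega, show rS + a + 1 - rS = a + 1 by omega,
        show rT + b + 1 - rT = b + 1 by omega, Nat.add_sub_cancel_left, Nat.add_sub_cancel_left]
      ring
    · obtain ⟨b, rfl⟩ : ∃ b, cUN = cT + b := ⟨cUN - cT, by omega⟩
      obtain rfl : rST = cS + cT + 1 := by omega
      subst h1 h2
      rw [show n - (rS + cT + 1) = a + b by omega, show rS + a + 1 - rS = a + 1 by omega,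
        show cT + b + 1 - (cT + 1) = b by omega, Nat.add_sub_cancel_left, Nat.add_sub_cancel_left]
      ring
  · obtain ⟨a, rfl⟩ : ∃ a, cNU = cS + a := ⟨cNU - cS, by omega⟩
    obtain h2 | h2 : rT = cT ∨ rT = cT + 1 := by omega
    · obtain ⟨b, rfl⟩ : ∃ b, cUN = cT + b := ⟨cUN - cT, by omega⟩
      obtain rfl : rST = cS + cT + 1 := by omega
      subst h1 h2
      rw [show n - (cS + rT + 1) = a + b by omega, show cS + a + 1 - (cS + 1) = a by omega,
        show rT + b + 1 - rT = b + 1 by omega, Nat.add_sub_cancel_left, Nat.add_sub_cancel_left]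
      ring
    · obtain ⟨b, rfl⟩ : ∃ b, cUN = cT + b := ⟨cUN - cT, by omega⟩
      obtain rfl : rST = cS + cT + 1 := by omega
      subst h1 h2
      rw [show n - (cS + cT + 1) = a + b by omega, show cS + a + 1 - (cS + 1) = a by omega,
        show cT + b + 1 - (cT + 1) = b by omega, Nat.add_sub_cancel_left, Nat.add_sub_cancel_left]
      ring

end

/-- The rank function of the extension of the restriction to `N` by a point `p` on the guts of a
2-separation `(U, N)`. -/
def gutsExt {α : Type*} [DecidableEq α] (r : Finset α → ℕ) (U N : Finset α) (p : α)
    (S : Finset α) : ℕ :=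
  if p ∈ S then r (U ∪ S ∩ N) - r U + 1 else r (S ∩ N)

section

variable {α : Type*} [DecidableEq α] {r : Finset α → ℕ}

theorem IsRk.gutsExt (hr : IsRk r) {U N : Finset α} {p : α} (hp : p ∉ N)
    (h : r U + r N = r (U ∪ N) + 1) : IsRk (gutsExt r U N p) where
  empty := by simp [_root_.gutsExt, hr.empty]
  insert_le e S := by
    have h1 := hr.insert_le e (S ∩ N)
    have h2 := hr.insert_le e (U ∪ S ∩ N)
    have h3 := hr.union_le U (S ∩ N)
    have h4 := hr.mono (show S ∩ N ⊆ insert e (S ∩ N) by grind)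
    have h5 := hr.mono (show U ∪ S ∩ N ⊆ insert e (U ∪ S ∩ N) by grind)
    have h6 := hr.mono (show U ⊆ U ∪ S ∩ N by grind)
    by_cases hep : p = e
    · subst hep
      have i : insert p S ∩ N = S ∩ N := by grind
      simp only [_root_.gutsExt, i, Finset.mem_insert_self, if_true]
      split_ifs <;> omega
    · have i : insert e S ∩ N = S ∩ N ∨ insert e S ∩ N = insert e (S ∩ N) := by grind
      simp only [_root_.gutsExt, Finset.mem_insert, hep, false_or]
      rcases i with i | i <;> simp only [i, Finset.union_insert] <;>
        split_ifs <;> omega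
  mono {S T} hST := by
    have hST' : S ∩ N ⊆ T ∩ N := Finset.inter_subset_inter_right hST
    have h1 := hr.mono hST'
    have h2 := hr.mono (Finset.union_subset_union (subset_refl U) hST')
    have h3 := hr.submod_of_subset (S := N) (T := U ∪ S ∩ N) (J := U ∪ N) (I := S ∩ N)
      (by grind) (by grind)
    have h6 := hr.mono (show U ⊆ U ∪ S ∩ N by grind)
    have := @hST p
    simp only [_root_.gutsExt]
    split_ifs <;> first | omega | tauto
  submod S T := by
    have i1 : (S ∪ T) ∩ N = S ∩ N ∪ T ∩ N := by grind
    have i2 : (S ∩ T) ∩ N = (S ∩ N) ∩ (T ∩ N) := by grind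
    have hS : S ∩ N ⊆ N := Finset.inter_subset_right
    have hT : T ∩ N ⊆ N := Finset.inter_subset_right
    simp only [_root_.gutsExt, i1, i2, Finset.mem_union, Finset.mem_inter]
    generalize S ∩ N = A at *
    generalize T ∩ N = B at *
    have h1 := hr.submod A B
    have h2 := hr.submod_of_subset (S := U ∪ A) (T := U ∪ B) (J := U ∪ (A ∪ B))
      (I := U ∪ (A ∩ B)) (by grind) (by grind)
    have h3 := hr.submod_of_subset (S := U ∪ A) (T := B) (J := U ∪ (A ∪ B))
      (I := A ∩ B) (by grind) (by grind)
    have h4 := hr.submod_of_subset (S := A) (T := U ∪ B) (J := U ∪ (A ∪ B))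
      (I := A ∩ B) (by grind) (by grind)
    have h6 := hr.mono (show U ⊆ U ∪ A by grind)
    have h7 := hr.mono (show U ⊆ U ∪ B by grind)
    have h8 := hr.mono (show U ⊆ U ∪ (A ∪ B) by grind)
    have h9 := hr.mono (show U ⊆ U ∪ (A ∩ B) by grind)
    by_cases k1 : p ∈ S <;> by_cases k2 : p ∈ T <;> simp only [k1, k2] <;> simp <;> omega

theorem gutsExt_of_subset {U N : Finset α} {p : α} (hp : p ∉ N) {S : Finset α} (hS : S ⊆ N) :
    gutsExt r U N p S = r S := by
  rw [gutsExt, if_neg fun h ↦ hp (hS h), Finset.inter_eq_left.2 hS]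

theorem gutsExt_insert {U N : Finset α} {p : α} (hp : p ∉ N) {S : Finset α} (hS : S ⊆ N) :
    gutsExt r U N p (insert p S) = ctr r U S + 1 := by
  rw [gutsExt, if_pos (Finset.mem_insert_self p S), Finset.insert_inter_of_notMem hp,
    Finset.inter_eq_left.2 hS, ctr]

theorem ctr_gutsExt (hr : IsRk r) {U N : Finset α} {p : α} (hp : p ∉ N) {S : Finset α}
    (hS : S ⊆ N) : ctr (gutsExt r U N p) {p} S = ctr r U S := by
  have h1 := gutsExt_insert (r := r) (U := U) hp hS
  have h2 := gutsExt_insert (r := r) (U := U) hp (Finset.empty_subset N)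
  rw [insert_empty_eq, (hr.ctr U).empty] at h2
  rw [ctr, ← Finset.insert_eq, h1, h2]
  omega

theorem hPoly_gutsExt (hr : IsRk r) {U N : Finset α} {p : α} (hp : p ∉ N)
    (h : r U + r N = r (U ∪ N) + 1) :
    hPoly (gutsExt r U N p) (insert p N) = hPoly r N + X * hPoly (ctr r U) N := by
  have h1 := gutsExt_insert (r := r) (U := U) hp (Finset.empty_subset N)
  rw [insert_empty_eq, (hr.ctr U).empty] at h1
  have h2 := ctr_add hr U N
  rw [hPoly_insert (hr.gutsExt hp h) hp h1,
    hPoly_congr fun S hS ↦ gutsExt_of_subset hp hS,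
    hPoly_congr (r := ctr (gutsExt r U N p) {p}) fun S hS ↦ ctr_gutsExt hr hp hS]
  rw [gutsExt_insert hp subset_rfl, gutsExt_of_subset hp subset_rfl]
  omega

theorem conn_of_left {E : Finset α} {e : α} (h : ∀ U N, Disjoint U N → U ∪ N = E → e ∈ U →
    N.Nonempty → r E < r U + r N) (he : e ∈ E) : Conn r E := by
  intro U N hd hUN hU hN
  rw [← hUN, Finset.mem_union] at he
  rcases he with he | he
  · exact h U N hd hUN he hN
  · rw [add_comm]
    exact h N U hd.symm (Finset.union_comm U N ▸ hUN) he hU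

theorem Conn.gutsExt (hr : IsRk r) {U N : Finset α} {p : α} (hd : Disjoint U N)
    (hp : p ∉ N) (h : r U + r N = r (U ∪ N) + 1) (hU : U.Nonempty) (hc : Conn r (U ∪ N)) :
    Conn (gutsExt r U N p) (insert p N) := by
  refine conn_of_left (e := p) ?_ (Finset.mem_insert_self p N)
  intro V W hVW hunion hpV hW
  obtain ⟨V, hpV', rfl⟩ : ∃ V', p ∉ V' ∧ insert p V' = V :=
    ⟨V.erase p, Finset.notMem_erase p V, Finset.insert_erase hpV⟩
  rw [Finset.disjoint_left] at hd hVW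
  have hVN : V ⊆ N := fun x hx ↦ by
    have := Finset.ext_iff.1 hunion x
    grind
  have hWN : W ⊆ N := fun x hx ↦ by
    have := Finset.ext_iff.1 hunion x
    grind
  have hVW' : V ∪ W = N := by
    ext x
    have := Finset.ext_iff.1 hunion x
    grind
  have := hc (U ∪ V) W (by rw [Finset.disjoint_left]; grind)
    (by rw [Finset.union_assoc, hVW']) (hU.mono Finset.subset_union_left) hW
  rw [gutsExt_insert hp hVN, gutsExt_of_subset hp hWN, gutsExt_insert hp subset_rfl]
  have := ctr_add hr U V
  have := ctr_add hr U N
  omega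

theorem Conn.singleton_eq_one (hr : IsRk r) {e : α} {E : Finset α} (he : e ∉ E)
    (hE : E.Nonempty) (hc : Conn r (insert e E)) : r {e} = 1 := by
  have h1 := hc {e} E (by simpa) rfl (by simp) hE
  have := hr.singleton_le e
  have := hr.le_insert e E
  omega

theorem Conn.rk_insert (hr : IsRk r) {e : α} {E : Finset α} (he : e ∉ E)
    (hE : E.Nonempty) (hc : Conn r (insert e E)) : r (insert e E) = r E := by
  have h1 := hc {e} E (by simpa) rfl (by simp) hE
  have := hr.singleton_le e
  have := hr.le_insert e E
  omega

/-- The matroid does not become disconnected by restriction to a side of a parallel connection. -/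
theorem Conn.parallel (hr : IsRk r) {e : α} {U N : Finset α} (hd : Disjoint U N)
    (hl : r {e} = 1)
    (h : r (insert e U) + r (insert e N) ≤ r (insert e (U ∪ N)) + 1)
    (hc : Conn r (insert e (U ∪ N))) : Conn r (insert e U) := by
  refine conn_of_left (e := e) (fun V W hVW hunion heV hW ↦ ?_) (Finset.mem_insert_self e U)
  have hVW' := Finset.disjoint_left.1 hVW
  have hd' := Finset.disjoint_left.1 hd
  have hmem := Finset.ext_iff.1 hunion
  simp only [Finset.mem_union, Finset.mem_insert] at hmem
  have h1 := hc (V ∪ N) W (Finset.disjoint_left.2 (by grind)) (Finset.ext (by grind))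
    ⟨e, by grind⟩ hW
  have h2 := hr.submod_of_subset (S := V) (T := insert e N) (J := V ∪ N) (I := {e})
    (by grind) (by grind)
  omega

/-- The matroid does not become disconnected by contraction of a side of a series connection. -/
theorem Conn.series (hr : IsRk r) {e : α} {U N : Finset α} (hd : Disjoint U N)
    (h : r U + r N ≤ r (U ∪ N))
    (hc : Conn r (insert e (U ∪ N))) : Conn (ctr r N) (insert e U) := by
  refine conn_of_left (e := e) (fun V W hVW hunion heV hW ↦ ?_) (Finset.mem_insert_self e U)
  have hVW' := Finset.disjoint_left.1 hVW
  have hd' := Finset.disjoint_left.1 hd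
  have hmem := Finset.ext_iff.1 hunion
  simp only [Finset.mem_union, Finset.mem_insert] at hmem
  have hWU : W ⊆ U := by grind
  have h1 := hc (N ∪ V) W (Finset.disjoint_left.2 (by grind)) (Finset.ext (by grind))
    ⟨e, by grind⟩ hW
  have h2 := rk_union_of_le hr h hWU subset_rfl
  rw [Finset.union_comm] at h2
  have h3 := ctr_add hr N V
  have h4 := ctr_add hr N W
  have h5 := ctr_add hr N (insert e U)
  rw [show N ∪ insert e U = insert e (U ∪ N) by grind] at h5
  omega

/-- The contraction of the base point of a series connection is connected. -/
theorem Conn.ctr_series (hr : IsRk r) {e : α} {U N : Finset α} (hd : Disjoint U N)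
    (hU : e ∉ U) (hN : e ∉ N) (hUne : U.Nonempty) (hNne : N.Nonempty)
    (h : r U + r N ≤ r (U ∪ N)) (hc : Conn r (insert e (U ∪ N))) :
    Conn (ctr r {e}) (U ∪ N) := by
  have he : e ∉ U ∪ N := by simp [hU, hN]
  have hne : (U ∪ N).Nonempty := hUne.mono Finset.subset_union_left
  have hl := hc.singleton_eq_one hr he hne
  have hcl := hc.rk_insert hr he hne
  intro V W hVW hunion hV hW
  by_contra! hle
  have c1 := ctr_singleton_add hr e V
  have c2 := ctr_singleton_add hr e W
  have c3 := ctr_singleton_add hr e (U ∪ N)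
  have key : ∀ V W, Disjoint V W → V ∪ W = U ∪ N →
      r (insert e V) + r (insert e W) ≤ r (U ∪ N) + 1 →
      (U ∩ V).Nonempty → (N ∩ W).Nonempty → False := by
    intro V W hVW hunion hle h1 h2
    have hVW' := Finset.disjoint_left.1 hVW
    have hd' := Finset.disjoint_left.1 hd
    have hmem := Finset.ext_iff.1 hunion
    simp only [Finset.mem_union] at hmem
    have a1 := hr.submod_of_subset (S := U) (T := insert e V) (J := insert e (U ∪ V))
      (I := U ∩ V) (by grind) (by grind)
    have a2 := hr.submod_of_subset (S := N) (T := insert e W) (J := insert e (N ∪ W))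
      (I := N ∩ W) (by grind) (by grind)
    have b1 := hc (insert e (U ∪ V)) (N ∩ W) (Finset.disjoint_left.2 (by grind))
      (Finset.ext (by grind)) ⟨e, by grind⟩ h2
    have b2 := hc (insert e (N ∪ W)) (U ∩ V) (Finset.disjoint_left.2 (by grind))
      (Finset.ext (by grind)) ⟨e, by grind⟩ h1
    omega
  have k1 := key V W hVW hunion (by omega)
  have k2 := key W V hVW.symm (Finset.union_comm V W ▸ hunion) (by omega)
  obtain ⟨u, hu⟩ := hUne
  obtain ⟨n, hn⟩ := hNne
  obtain ⟨v, hv⟩ := hV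
  obtain ⟨w, hw⟩ := hW
  have e1 : U ∩ V = ∅ ∨ N ∩ W = ∅ := by
    by_contra! h3
    exact k1 h3.1 h3.2
  have e2 : U ∩ W = ∅ ∨ N ∩ V = ∅ := by
    by_contra! h3
    exact k2 h3.1 h3.2
  simp only [Finset.eq_empty_iff_forall_notMem, Finset.mem_inter, not_and] at e1 e2
  have hmem := Finset.ext_iff.1 hunion
  simp only [Finset.mem_union] at hmem
  have mu := (hmem u).2 (Or.inl hu)
  have mn := (hmem n).2 (Or.inr hn)
  have mv := (hmem v).1 (Or.inl hv)
  have mw := (hmem w).1 (Or.inr hw)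
  rcases e1 with e1 | e1 <;> rcases e2 with e2 | e2
  · exact mu.elim (e1 u hu) (e2 u hu)
  · exact mv.elim (fun h ↦ e1 v h hv) (fun h ↦ e2 v h hv)
  · exact mw.elim (fun h ↦ e2 w h hw) (fun h ↦ e1 w h hw)
  · exact mn.elim (e2 n hn) (e1 n hn)

end

/-- The h-polynomials of a matroid on `insert e E` and of its contraction by `e` form a pair in
the cone `segPairCone`. -/
def HPair {α : Type*} [DecidableEq α] (r : Finset α → ℕ) (e : α) (E : Finset α) : Prop :=
  (hPoly r (insert e E), hPoly (ctr r {e}) E) ∈ segPairCone (r (insert e E) - 1)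

/-- The property `HPair` holds for all connected matroids on `insert f F` with `F` of cardinality
less than `m`. -/
def HPairBelow (α : Type*) [DecidableEq α] (m : ℕ) : Prop :=
  ∀ (r : Finset α → ℕ) (f : α) (F : Finset α), F.card < m → IsRk r → f ∉ F → F.Nonempty →
    Conn r (insert f F) → HPair r f F

section

variable {α : Type*} [DecidableEq α] {r : Finset α → ℕ}

theorem HPair.fst_mem {e : α} {E : Finset α} (h : HPair r e E) :
    hPoly r (insert e E) ∈ segCone (r (insert e E) - 1) :=
  fst_mem_segCone (p := (_, hPoly (ctr r {e}) E)) h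

theorem HPair.sub_mem {e : α} {E : Finset α} (h : HPair r e E) :
    hPoly r (insert e E) - hPoly (ctr r {e}) E ∈ segCone (r (insert e E) - 1) :=
  fst_sub_snd_mem_segCone (p := (_, _)) h

theorem hPoly_singleton (hr : IsRk r) {e : α} (h : r {e} = 1) : hPoly r {e} = 1 := by
  have h1 := hPoly_insert_eq_sum r (Finset.notMem_empty e)
  rw [insert_empty_eq] at h1
  rw [h1]
  simp [hTerm, h, hr.empty]

theorem Conn.eq_of_conn_ctr (hr : IsRk r) {e : α} {E : Finset α} (he : e ∉ E) (hE : E.Nonempty)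
    (hc : Conn r (insert e E)) : ctr r {e} E + 1 = r E := by
  have h1 := ctr_singleton_add hr e E
  rwa [hc.singleton_eq_one hr he hE, hc.rk_insert hr he hE] at h1

theorem hPair_singleton (hr : IsRk r) {e f : α} (hef : e ∉ ({f} : Finset α))
    (hc : Conn r (insert e {f})) : HPair r e {f} := by
  have h1 := hc.singleton_eq_one hr hef (by simp)
  have h2 := hc.rk_insert hr hef (by simp)
  have h3 := hc.eq_of_conn_ctr hr hef (by simp)
  have h4 := hr.singleton_le f
  have h5 := hPoly_insert_of_loop (hr.ctr {e}) (Finset.notMem_empty f)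
    (by omega)
  rw [insert_empty_eq] at h5
  rw [HPair, hPoly_insert hr hef h1 h2, h5, mul_zero, add_zero, hPoly_singleton hr (by omega),
    ← pow_zero X, ← seg_one 0]
  exact prod_zero_mem_segPairCone (seg_mem_segCone (by omega))

theorem hPair_of_not_conn_ctr (hr : IsRk r) {e : α} {E : Finset α} (he : e ∉ E)
    (hE : E.Nonempty) (hc : Conn r (insert e E)) (hcc : ¬ Conn (ctr r {e}) E)
    (ih : HPairBelow α E.card) : HPair r e E := by
  have hl := hc.singleton_eq_one hr he hE
  simp only [Conn, not_forall, not_lt] at hcc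
  obtain ⟨U, N, hd, rfl, hU, hN, hle⟩ := hcc
  rw [Finset.mem_union, not_or] at he
  have hc1 := ctr_singleton_add hr e U
  have hc2 := ctr_singleton_add hr e N
  have hc3 := ctr_singleton_add hr e (U ∪ N)
  have hle' : r (insert e U) + r (insert e N) ≤ r (insert e (U ∪ N)) + 1 := by omega
  have hsum := rk_union_of_le (hr.ctr {e}) hle subset_rfl subset_rfl
  have hcU := Conn.parallel hr hd hl hle' hc
  have hcN := Conn.parallel (U := N) (N := U) hr hd.symm hl
    (by rw [Finset.union_comm]; omega) (Finset.union_comm U N ▸ hc)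
  have hcard := Finset.card_union_of_disjoint hd
  have p1 := ih r e U (by have := hN.card_pos; omega) hr he.1 hU hcU
  have p2 := ih r e N (by have := hU.card_pos; omega) hr he.2 hN hcN
  have key := mul_mem_segPairCone p1 p2
  rw [HPair, hPoly_insert_union hr hd he.1 he.2 hl hle', hPoly_union (hr.ctr {e}) hd hle,
    ← Prod.mk_mul_mk]
  convert key using 2
  have := hcU.rk_insert hr he.1 hU
  omega

theorem hPair_of_not_conn (hr : IsRk r) {e : α} {E : Finset α} (he : e ∉ E)
    (hE : E.Nonempty) (hc : Conn r (insert e E)) (hcd : ¬ Conn r E)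
    (ih : HPairBelow α E.card) : HPair r e E := by
  have hl := hc.singleton_eq_one hr he hE
  have hcl := hc.rk_insert hr he hE
  simp only [Conn, not_forall, not_lt] at hcd
  obtain ⟨U, N, hd, rfl, hU, hN, hle⟩ := hcd
  have he' := he
  rw [Finset.mem_union, not_or] at he
  have hsum := rk_union_of_le hr hle subset_rfl subset_rfl
  have hc' : Conn r (insert e (N ∪ U)) := Finset.union_comm U N ▸ hc
  have hle' : r N + r U ≤ r (N ∪ U) := by rw [Finset.union_comm]; omega
  have heU : r (insert e U) = r U + 1 := by
    have h1 := hc (insert e U) N (by simp [he.2, hd]) (Finset.insert_union e U N) (by simp) hN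
    have := hr.insert_le e U
    omega
  have heN : r (insert e N) = r N + 1 := by
    have h1 := hc' (insert e N) U (by simp [he.1, hd.symm]) (Finset.insert_union e N U)
      (by simp) hU
    rw [Finset.union_comm] at h1
    have := hr.insert_le e N
    omega
  have hcU := Conn.series hr hd hle hc
  have hcN := Conn.series hr hd.symm hle' hc'
  have hcc := Conn.ctr_series hr hd he.1 he.2 hU hN hle hc
  have hcard := Finset.card_union_of_disjoint hd
  have hUpos := hU.card_pos
  have hNpos := hN.card_pos
  have p1 := ih (ctr r N) e U (by omega) (hr.ctr N) he.1 hU hcU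
  have p2 := ih (ctr r U) e N (by omega) (hr.ctr U) he.2 hN hcN
  have r1 := ctr_add hr N (insert e U)
  have r2 := ctr_add hr U (insert e N)
  rw [show N ∪ insert e U = insert e (U ∪ N) by grind] at r1
  rw [show U ∪ insert e N = insert e (U ∪ N) by grind] at r2
  have hD := hPoly_sub_hPoly_series hr hd he.1 he.2 hle hcl heU heN
  have hA : hPoly r (insert e (U ∪ N)) - X * hPoly (ctr r {e}) (U ∪ N) =
      (hPoly (ctr r N) (insert e U) - X * hPoly (ctr (ctr r N) {e}) U) *
      (hPoly (ctr r U) (insert e N) - X * hPoly (ctr (ctr r U) {e}) N) := by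
    rw [hPoly_insert hr he' hl hcl, hPoly_insert (hr.ctr N) he.1 (hcU.singleton_eq_one
      (hr.ctr N) he.1 hU) (hcU.rk_insert (hr.ctr N) he.1 hU), hPoly_insert (hr.ctr U) he.2
      (hcN.singleton_eq_one (hr.ctr U) he.2 hN) (hcN.rk_insert (hr.ctr U) he.2 hN),
      hPoly_union hr hd hle]
    simp only [add_sub_cancel_right]
    congr 1 <;> refine hPoly_congr fun S hS ↦ ?_
    · have h1 := ctr_add hr N S
      rw [Finset.union_comm, rk_union_of_le hr hle hS subset_rfl] at h1
      omega
    · have h1 := ctr_add hr U S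
      rw [rk_union_of_le hr hle subset_rfl hS] at h1
      omega
  have c1 := hc.eq_of_conn_ctr hr he' hE
  have hD1 := hcU.rk_insert (hr.ctr N) he.1 hU
  have hD2 := hcN.rk_insert (hr.ctr U) he.2 hN
  have e1 := hcU.singleton_eq_one (hr.ctr N) he.1 hU
  have e2 := hcN.singleton_eq_one (hr.ctr U) he.2 hN
  have m1 := (hr.ctr N).mono (show {e} ⊆ insert e U by simp)
  have m2 := (hr.ctr U).mono (show {e} ⊆ insert e N by simp)
  have hB : hPoly (ctr r {e}) (U ∪ N) ∈ segCone (r (insert e (U ∪ N)) - 1 - 1) := by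
    obtain ⟨f, hf⟩ := hE
    rw [← Finset.insert_erase hf] at hcc ⊢
    have hF := Finset.card_erase_add_one hf
    have := (ih (ctr r {e}) f ((U ∪ N).erase f) (by omega) (hr.ctr {e})
      (Finset.notMem_erase f _) (Finset.card_pos.1 (by omega)) hcc).fst_mem
    rw [Finset.insert_erase hf] at this ⊢
    exact segCone_anti (by omega) this
  have hDmem := X_mul_mem_segCone (mul_mem_segCone p1.sub_mem p2.sub_mem)
  rw [← hD] at hDmem
  have hAnn : ∀ k, 0 ≤ (hPoly r (insert e (U ∪ N)) - X * hPoly (ctr r {e}) (U ∪ N)).coeff k := by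
    intro k
    rw [hA, coeff_mul]
    exact Finset.sum_nonneg fun x _ ↦ mul_nonneg (coeff_fst_sub_X_mul_snd_nonneg (p := (_, _)) p1 _)
      (coeff_fst_sub_X_mul_snd_nonneg (p := (_, _)) p2 _)
  refine mem_segPairCone_of_mem_segCone (by omega) hB (segCone_anti (by omega) hDmem) hAnn ?_
  intro k hk
  cases k with
  | zero =>
    rw [hD, coeff_X_mul_zero]
    exact hAnn _
  | succ k =>
    rw [hD, coeff_X_mul, hA]
    exact coeff_mul_le_of_mem_segPairCone (p := (_, _)) (q := (_, _)) p1 p2 (by omega) (by omega)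

end

section

variable {α : Type*} [DecidableEq α] {r : Finset α → ℕ}

theorem rk_insert_of_two_sep (hr : IsRk r) {e : α} {U N : Finset α} (hd : Disjoint U N)
    (hU : U.Nonempty) (hN : N.Nonempty) (hl : r {e} = 1) (hcc : Conn (ctr r {e}) (U ∪ N))
    (heq : r (insert e U) + r N = r (insert e (U ∪ N)) + 1) : r (insert e N) = r N + 1 := by
  have h := hcc U N hd rfl hU hN
  have h1 := ctr_singleton_add hr e U
  have h2 := ctr_singleton_add hr e N
  have h3 := ctr_singleton_add hr e (U ∪ N)
  have h4 := hr.insert_le e N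
  omega

theorem Conn.insert_of_two_sep (hr : IsRk r) {e : α} {U N : Finset α} (hU : e ∉ U)
    (hd : Disjoint U N) (hUne : U.Nonempty) (hNne : N.Nonempty) (hl : r {e} = 1)
    (hcl : r (insert e (U ∪ N)) = r (U ∪ N)) (hcE : Conn r (U ∪ N))
    (heq : r (insert e U) + r N = r (insert e (U ∪ N)) + 1)
    (hmin : ∀ V ⊂ U, V.Nonempty →
      r (insert e (U ∪ N)) + 1 < r (insert e V) + r ((U ∪ N) \ V)) : Conn r (insert e U) := by
  refine conn_of_left (e := e) (fun V W hVW hunion heV hW ↦ ?_) (Finset.mem_insert_self e U)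
  obtain ⟨V, heV', rfl⟩ : ∃ V', e ∉ V' ∧ insert e V' = V :=
    ⟨V.erase e, Finset.notMem_erase e V, Finset.insert_erase heV⟩
  have hVW' := Finset.disjoint_left.1 hVW
  have hd' := Finset.disjoint_left.1 hd
  have hmem := Finset.ext_iff.1 hunion
  simp only [Finset.mem_union, Finset.mem_insert] at hmem hVW'
  obtain ⟨w, hw⟩ := hW
  rcases V.eq_empty_or_nonempty with rfl | hV
  · have hWU : W = U := Finset.ext (by grind)
    have := hcE U N hd rfl hUne hNne
    rw [hWU, insert_empty_eq]
    omega
  · have h1 := hmin V (Finset.ssubset_iff_subset_ne.2 ⟨fun x ↦ by grind, by grind⟩) hV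
    have h2 : (U ∪ N) \ V = W ∪ N := Finset.ext (by grind)
    have h3 := hr.union_le W N
    rw [h2] at h1
    omega

theorem Conn.ctr_insert_of_two_sep (hr : IsRk r) {e : α} {U N : Finset α} (hU : e ∉ U)
    (hd : Disjoint U N)
    (hcl : r (insert e (U ∪ N)) = r (U ∪ N)) (heN : r (insert e N) = r N + 1)
    (heq : r (insert e U) + r N = r (insert e (U ∪ N)) + 1)
    (hmin : ∀ V ⊂ U, V.Nonempty →
      r (insert e (U ∪ N)) + 1 < r (insert e V) + r ((U ∪ N) \ V)) :
    Conn (ctr r N) (insert e U) := by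
  refine conn_of_left (e := e) (fun V W hVW hunion heV hW ↦ ?_) (Finset.mem_insert_self e U)
  obtain ⟨V, heV', rfl⟩ : ∃ V', e ∉ V' ∧ insert e V' = V :=
    ⟨V.erase e, Finset.notMem_erase e V, Finset.insert_erase heV⟩
  have hVW' := Finset.disjoint_left.1 hVW
  have hd' := Finset.disjoint_left.1 hd
  have hmem := Finset.ext_iff.1 hunion
  simp only [Finset.mem_union, Finset.mem_insert] at hmem hVW'
  obtain ⟨w, hw⟩ := hW
  have r1 := ctr_add hr N (insert e V)
  have r2 := ctr_add hr N W
  have r3 := ctr_add hr N (insert e U)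
  rw [show N ∪ insert e U = insert e (U ∪ N) by grind] at r3
  rcases V.eq_empty_or_nonempty with rfl | hV
  · have hWU : W = U := Finset.ext (by grind)
    rw [Finset.union_insert, Finset.union_empty] at r1
    rw [hWU, Finset.union_comm] at r2
    rw [hWU]
    omega
  · have h1 := hmin V (Finset.ssubset_iff_subset_ne.2 ⟨fun x ↦ by grind, by grind⟩) hV
    have h2 : (U ∪ N) \ V = N ∪ W := Finset.ext (by grind)
    have h3 := hr.submod_of_subset (S := N ∪ insert e V) (T := insert e U)
      (J := insert e (U ∪ N)) (I := insert e V) (fun x ↦ by grind) (fun x ↦ by grind)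
    rw [h2] at h1
    omega

theorem hPoly_sub_hPoly_mem_of_two_sep (hr : IsRk r) {e : α} {U N : Finset α} (he : e ∉ U ∪ N)
    (hd : Disjoint U N) (hU : U.Nonempty) (hN : 2 ≤ N.card) (hc : Conn r (insert e (U ∪ N)))
    (hcE : Conn r (U ∪ N)) (hcc : Conn (ctr r {e}) (U ∪ N))
    (hle : r (insert e U) + r N ≤ r (insert e (U ∪ N)) + 1)
    (hmin : ∀ V ⊂ U, V.Nonempty →
      r (insert e (U ∪ N)) + 1 < r (insert e V) + r ((U ∪ N) \ V))
    (ih : HPairBelow α (U ∪ N).card) :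
    hPoly r (insert e (U ∪ N)) - hPoly (ctr r {e}) (U ∪ N) ∈
      segCone (r (insert e (U ∪ N)) - 1) := by
  have hE : (U ∪ N).Nonempty := hU.mono Finset.subset_union_left
  have hNne : N.Nonempty := Finset.card_pos.1 (by omega)
  have hl := hc.singleton_eq_one hr he hE
  have hcl := hc.rk_insert hr he hE
  rw [Finset.mem_union, not_or] at he
  have hde : Disjoint (insert e U) N := Finset.disjoint_insert_left.2 ⟨he.2, hd⟩
  have heq : r (insert e U) + r N = r (insert e (U ∪ N)) + 1 := by
    have := hc (insert e U) N hde (Finset.insert_union e U N) (by simp) hNne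
    omega
  have heN := rk_insert_of_two_sep hr hd hU hNne hl hcc heq
  have hcU := Conn.insert_of_two_sep hr he.1 hd hU hNne hl hcl hcE heq hmin
  have hcU' := Conn.ctr_insert_of_two_sep hr he.1 hd hcl heN heq hmin
  have heq' : r (insert e U) + r N = r (insert e U ∪ N) + 1 := by rwa [Finset.insert_union]
  have hcN := Conn.gutsExt hr hde he.2 heq' (by simp) (by rwa [Finset.insert_union])
  have hcard := Finset.card_union_of_disjoint hd
  have hUpos := hU.card_pos
  have p1 := ih r e U (by omega) hr he.1 hU hcU
  have p2 := ih (ctr r N) e U (by omega) (hr.ctr N) he.1 hU hcU'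
  have p3 := ih (gutsExt r (insert e U) N e) e N (by omega) (hr.gutsExt he.2 heq') he.2 hNne hcN
  have r2 := ctr_add hr N (insert e U)
  have r3 := ctr_add hr (insert e U) N
  rw [show N ∪ insert e U = insert e (U ∪ N) by grind] at r2
  rw [Finset.insert_union] at r3
  have m2 := hcU'.singleton_eq_one (hr.ctr N) he.1 hU
  have m2' := (hr.ctr N).mono (show {e} ⊆ insert e U by simp)
  have s3 := p3.sub_mem
  have f3 := p3.fst_mem
  rw [hPoly_congr fun S hS ↦ ctr_gutsExt hr he.2 hS] at s3
  rw [hPoly_gutsExt hr he.2 heq', gutsExt_insert he.2 subset_rfl] at s3 f3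
  have hcN' : hPoly (ctr r {e}) N = hPoly r N := by
    refine hPoly_congr fun S hS ↦ ?_
    have h1 := hr.submod_of_subset (S := insert e S) (T := N) (J := insert e N) (I := S)
      (fun x ↦ by grind) (fun x ↦ by grind)
    have h2 := hr.insert_le e S
    have h3 := ctr_singleton_add hr e S
    omega
  have c1 := ctr_singleton_add hr e U
  have c2 := ctr_singleton_add hr e N
  have c3 := ctr_singleton_add hr e (U ∪ N)
  have e1 := hPoly_union_of_two_sep hr hde heq'
  have e2 := hPoly_union_of_two_sep (hr.ctr {e}) hd (by omega)
  rw [Finset.insert_union] at e1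
  rw [ctr_ctr hr, ctr_ctr hr, ← Finset.insert_eq, hcN', Finset.union_comm {e} N,
    ← ctr_ctr hr] at e2
  have hD : hPoly r (insert e (U ∪ N)) - hPoly (ctr r {e}) (U ∪ N) =
      (hPoly r (insert e U) - hPoly (ctr r {e}) U) *
        (hPoly r N + X * hPoly (ctr r (insert e U)) N) +
      X * ((hPoly (ctr r N) (insert e U) - hPoly (ctr (ctr r N) {e}) U) *
        (hPoly r N + X * hPoly (ctr r (insert e U)) N - hPoly (ctr r (insert e U)) N)) := by
    rw [e1, e2]
    ring
  rw [hD]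
  exact add_mem (segCone_anti (by omega) (mul_mem_segCone p1.sub_mem f3))
    (segCone_anti (by omega) (X_mul_mem_segCone (mul_mem_segCone p2.sub_mem s3)))

theorem hPoly_sub_hPoly_mem_of_no_two_sep (hr : IsRk r) {e f : α} {F : Finset α}
    (hf : f ∉ F) (he : e ∉ insert f F) (hF : 2 ≤ F.card) (hc : Conn r (insert e (insert f F)))
    (hcc : Conn (ctr r {e}) (insert f F))
    (hno : ∀ U N, Disjoint U N → U ∪ N = insert f F → U.Nonempty → 2 ≤ N.card →
      r (insert e (insert f F)) + 1 < r (insert e U) + r N)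
    (ih : HPairBelow α (insert f F).card) :
    hPoly r (insert e (insert f F)) - hPoly (ctr r {e}) (insert f F) ∈
      segCone (r (insert e (insert f F)) - 1) := by
  have hFne : F.Nonempty := Finset.card_pos.1 (by omega)
  rw [Finset.mem_insert, not_or] at he
  have hfe : f ∉ insert e F := by simp [hf, Ne.symm he.1]
  have hno' : ∀ V W : Finset α, Disjoint V W → V ∪ W = insert e F → e ∈ V → W.Nonempty →
      r (insert e (insert f F)) + 1 < r (insert f V) + r W ∨
      r (insert e (insert f F)) + 1 < r V + r (insert f W) := by
    intro V W hVW hunion heV hW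
    obtain ⟨V, heV', rfl⟩ : ∃ V', e ∉ V' ∧ insert e V' = V :=
      ⟨V.erase e, Finset.notMem_erase e V, Finset.insert_erase heV⟩
    have hcard := Finset.card_union_of_disjoint hVW
    rw [hunion, Finset.card_insert_of_notMem he.2, Finset.card_insert_of_notMem heV'] at hcard
    have hVW' := Finset.disjoint_left.1 hVW
    have hmem := Finset.ext_iff.1 hunion
    simp only [Finset.mem_union, Finset.mem_insert] at hmem hVW'
    by_cases hW2 : 2 ≤ W.card
    · left
      rw [Finset.insert_comm f e V]
      exact hno (insert f V) W (Finset.disjoint_left.2 (by grind)) (Finset.ext (by grind))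
        (by simp) hW2
    · right
      have hWpos := hW.card_pos
      have hfW : f ∉ W := by grind
      refine hno V (insert f W) (Finset.disjoint_left.2 (by grind)) (Finset.ext (by grind))
        (Finset.card_pos.1 (by omega)) ?_
      rw [Finset.card_insert_of_notMem hfW]
      omega
  have hmono := hr.mono (show insert e F ⊆ insert e (insert f F) by grind)
  have hcF : Conn r (insert e F) := by
    refine conn_of_left (e := e) (fun V W hVW hunion heV hW ↦ ?_) (Finset.mem_insert_self e F)
    have h1 := hr.insert_le f V
    have h2 := hr.insert_le f W
    rcases hno' V W hVW hunion heV hW with h | h <;> omega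
  have hcF' : Conn (ctr r {f}) (insert e F) := by
    refine conn_of_left (e := e) (fun V W hVW hunion heV hW ↦ ?_) (Finset.mem_insert_self e F)
    have h1 := ctr_singleton_add hr f V
    have h2 := ctr_singleton_add hr f W
    have h3 := ctr_singleton_add hr f (insert e F)
    have h4 := hr.singleton_le f
    have h5 := hr.le_insert f V
    have h6 := hr.le_insert f W
    rw [Finset.insert_comm] at h3
    rcases hno' V W hVW hunion heV hW with h | h <;> omega
  have hcard := Finset.card_insert_of_notMem hf
  have p1 := (ih r e F (by omega) hr he.2 hFne hcF).sub_mem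
  have p2 := (ih (ctr r {f}) e F (by omega) (hr.ctr {f}) he.2 hFne hcF').sub_mem
  have hl := (hcc.singleton_eq_one (hr.ctr {e}) hf hFne)
  have hcl := hcc.rk_insert (hr.ctr {e}) hf hFne
  rw [Finset.insert_comm] at hc hmono ⊢
  have hl' := hc.singleton_eq_one hr hfe (by simp)
  have hcl' := hc.rk_insert hr hfe (by simp)
  have h3 := ctr_singleton_add hr f (insert e F)
  have hD : hPoly r (insert f (insert e F)) - hPoly (ctr r {e}) (insert f F) =
      (hPoly r (insert e F) - hPoly (ctr r {e}) F) +
      X * (hPoly (ctr r {f}) (insert e F) - hPoly (ctr (ctr r {f}) {e}) F) := by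
    rw [hPoly_insert hr hfe hl' hcl', hPoly_insert (hr.ctr {e}) hf hl hcl, ctr_ctr hr,
      ctr_ctr hr, Finset.union_comm {e}]
    ring
  rw [hD]
  exact add_mem (segCone_anti (by omega) p1) (segCone_anti (by omega) (X_mul_mem_segCone p2))

theorem hPoly_sub_hPoly_mem (hr : IsRk r) {e : α} {E : Finset α} (he : e ∉ E)
    (hE : 3 ≤ E.card) (hc : Conn r (insert e E)) (hcE : Conn r E) (hcc : Conn (ctr r {e}) E)
    (ih : HPairBelow α E.card) :
    hPoly r (insert e E) - hPoly (ctr r {e}) E ∈ segCone (r (insert e E) - 1) := by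
  by_cases hno : ∀ U N, Disjoint U N → U ∪ N = E → U.Nonempty → 2 ≤ N.card →
      r (insert e E) + 1 < r (insert e U) + r N
  · obtain ⟨f, hf⟩ := Finset.card_pos.1 (show 0 < E.card by omega)
    have hcard := Finset.card_erase_add_one hf
    have hins := Finset.insert_erase hf
    have key := hPoly_sub_hPoly_mem_of_no_two_sep hr (e := e) (Finset.notMem_erase f E)
    rw [hins] at key
    exact key he (by omega) hc hcc hno ih
  · push Not at hno
    obtain ⟨U₀, N₀, hd₀, rfl, hU₀, hN₀, hle₀⟩ := hno
    set E := U₀ ∪ N₀ with hEdef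
    have hs : U₀ ∈ E.powerset.filter fun U ↦ U.Nonempty ∧ 2 ≤ (E \ U).card ∧
        r (insert e U) + r (E \ U) ≤ r (insert e E) + 1 := by
      rw [Finset.mem_filter, Finset.mem_powerset, hEdef, Finset.union_sdiff_cancel_left hd₀]
      exact ⟨Finset.subset_union_left, hU₀, hN₀, hle₀⟩
    obtain ⟨U, hU, hmin⟩ := Finset.exists_min_image _ Finset.card ⟨U₀, hs⟩
    simp only [Finset.mem_filter, Finset.mem_powerset] at hU hmin
    obtain ⟨hUE, hUne, hcard, hle⟩ := hU
    have hunion := Finset.union_sdiff_of_subset hUE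
    have key := hPoly_sub_hPoly_mem_of_two_sep hr (e := e) (U := U) (N := E \ U)
    rw [hunion] at key
    refine key he Finset.disjoint_sdiff hUne hcard hc hcE hcc hle (fun V hV hVne ↦ ?_) ih
    by_contra! hlt
    have h1 := Finset.card_le_card (Finset.sdiff_subset_sdiff (subset_refl E) hV.subset)
    have h2 := hmin V ⟨hV.subset.trans hUE, hVne, by omega, hlt⟩
    have h3 := Finset.card_lt_card hV
    omega

theorem hPair_of_conn_of_conn (hr : IsRk r) {e : α} {E : Finset α} (he : e ∉ E)
    (hE : 2 ≤ E.card) (hc : Conn r (insert e E)) (hcE : Conn r E) (hcc : Conn (ctr r {e}) E)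
    (ih : HPairBelow α E.card) : HPair r e E := by
  have hEne : E.Nonempty := Finset.card_pos.1 (by omega)
  have hl := hc.singleton_eq_one hr he hEne
  have hcl := hc.rk_insert hr he hEne
  have c1 := hc.eq_of_conn_ctr hr he hEne
  obtain ⟨f, hf⟩ := hEne
  have hcard := Finset.card_erase_add_one hf
  have hins := Finset.insert_erase hf
  have hFne : (E.erase f).Nonempty := Finset.card_pos.1 (by omega)
  have hfF := Finset.notMem_erase f E
  rw [← hins] at hcE hcc
  have p1 := (ih r f (E.erase f) (by omega) hr hfF hFne hcE).fst_mem
  have p2 := (ih (ctr r {e}) f (E.erase f) (by omega) (hr.ctr {e}) hfF hFne hcc).fst_mem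
  have hl2 := hcc.singleton_eq_one (hr.ctr {e}) hfF hFne
  have m2 := (hr.ctr {e}).mono (show {f} ⊆ E by simpa)
  have hE3 : 3 ≤ E.card := by
    by_contra! hlt
    obtain ⟨g, hg⟩ := Finset.card_eq_one.1 (show (E.erase f).card = 1 by omega)
    have h1 := hcE {f} (E.erase f) (by simp) rfl (by simp) hFne
    rw [hins, hg] at h1
    have h2 := hr.singleton_le f
    have h3 := hr.singleton_le g
    omega
  rw [hins] at p1 p2 hcE hcc
  have hD := hPoly_sub_hPoly_mem hr he hE3 hc hcE hcc ih
  have hA : hPoly r (insert e E) - X * hPoly (ctr r {e}) E = hPoly r E := by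
    rw [hPoly_insert hr he hl hcl, add_sub_cancel_right]
  refine mem_segPairCone_of_mem_segCone (by omega) (segCone_anti (by omega) p2) hD ?_ ?_
  · intro k
    rw [hA]
    exact coeff_nonneg_of_mem_segCone p1 k
  · intro k hk
    rw [hA]
    refine le_trans ?_ ((coeff_le_coeff_sub_of_mem_segCone p1 (k := k) (by omega)).trans_eq ?_)
    · rw [hPoly_insert hr he hl hcl, coeff_sub, coeff_add]
      cases k with
      | zero =>
        rw [coeff_X_mul_zero]
        linarith [coeff_nonneg_of_mem_segCone p2 0]
      | succ k =>
        rw [coeff_X_mul]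
        linarith [coeff_le_coeff_succ_of_mem_segCone p2 (k := k) (by omega)]
    · rw [hcl]

theorem hPair_of_conn (hr : IsRk r) {e : α} {E : Finset α} (he : e ∉ E)
    (hE : E.Nonempty) (hc : Conn r (insert e E)) : HPair r e E := by
  induction h : E.card using Nat.strong_induction_on generalizing r e E with
  | _ m ih =>
    subst h
    have ih' : HPairBelow α E.card := fun r f F hF hr hf hFne hc ↦ ih _ hF hr hf hFne hc rfl
    by_cases hcE : Conn r E
    · by_cases hcc : Conn (ctr r {e}) E
      · by_cases hE2 : 2 ≤ E.card
        · exact hPair_of_conn_of_conn hr he hE2 hc hcE hcc ih'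
        · have := hE.card_pos
          obtain ⟨f, rfl⟩ := Finset.card_eq_one.1 (show E.card = 1 by omega)
          exact hPair_singleton hr he hc
      · exact hPair_of_not_conn_ctr hr he hE hc hcc ih'
    · exact hPair_of_not_conn hr he hE hc hcE ih'

end

theorem coeff_one_sub_X_pow (n k : ℕ) :
    ((1 - X : ℤ[X]) ^ n).coeff k = (-1) ^ k * (n.choose k : ℤ) := by
  induction n generalizing k with
  | zero => cases k <;> simp [coeff_one]
  | succ n ih =>
    rw [pow_succ', sub_mul, one_mul, coeff_sub, ih]
    cases k with
    | zero => simp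
    | succ k =>
      rw [coeff_X_mul, ih, Nat.choose_succ_succ]
      push_cast
      ring

theorem coeff_hTerm {α : Type*} {r : Finset α → ℕ} {n k : ℕ} {S : Finset α} (hS : r S ≤ n)
    (hk : k ≤ n) :
    (hTerm r n S).coeff k = (-1) ^ k * ((-1) ^ S.card * ((n - r S).choose (n - k) : ℤ)) := by
  have h : hTerm r n S = C ((-1) ^ S.card * (-1) ^ r S) * (X ^ r S * (1 - X) ^ (n - r S)) := by
    rw [hTerm, neg_pow (X : ℤ[X])]
    simp only [map_mul, map_pow, map_neg, map_one]
    ring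
  rw [h, coeff_C_mul, coeff_X_pow_mul']
  split_ifs with hrk
  · rw [coeff_one_sub_X_pow, ← Nat.choose_symm (show n - k ≤ n - r S by omega),
      show n - r S - (n - k) = k - r S by omega]
    nth_rw 3 [show k = r S + (k - r S) by omega]
    rw [pow_add]
    ring
  · rw [Nat.choose_eq_zero_of_lt (by omega)]
    simp

theorem natDegree_hTerm_le {α : Type*} {r : Finset α → ℕ} {n : ℕ} {S : Finset α} (hS : r S ≤ n) :
    (hTerm r n S).natDegree ≤ n := by
  unfold hTerm
  compute_degree
  omega

section

variable {α : Type*} [DecidableEq α] {r : Finset α → ℕ}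

theorem natDegree_hPoly_le (hr : IsRk r) (E : Finset α) : (hPoly r E).natDegree ≤ r E :=
  natDegree_sum_le_of_forall_le _ _ fun _ hS ↦
    natDegree_hTerm_le (hr.mono (Finset.mem_powerset.1 hS))

theorem coeff_hPoly (hr : IsRk r) {E : Finset α} {k : ℕ} (hk : k ≤ r E) :
    (hPoly r E).coeff k =
      (-1) ^ k * ∑ S ∈ E.powerset, (-1) ^ S.card * ((r E - r S).choose (r E - k) : ℤ) := by
  rw [hPoly, finsetSum_coeff, Finset.mul_sum]
  exact Finset.sum_congr rfl fun S hS ↦ coeff_hTerm (hr.mono (Finset.mem_powerset.1 hS)) hk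

theorem coeff_zero_hPoly (hr : IsRk r) {E : Finset α} (hl : ∀ e ∈ E, r {e} = 1) :
    (hPoly r E).coeff 0 = 1 := by
  rw [coeff_hPoly hr (Nat.zero_le _), Finset.sum_eq_single_of_mem ∅ (Finset.empty_mem_powerset E)]
  · simp [hr.empty]
  · intro S hS hne
    obtain ⟨e, he⟩ := Finset.nonempty_iff_ne_empty.2 hne
    have h1 := hl e (Finset.mem_powerset.1 hS he)
    have h2 := hr.mono (Finset.singleton_subset_iff.2 he)
    have h3 := hr.mono (Finset.mem_powerset.1 hS)
    rw [Nat.choose_eq_zero_of_lt (by omega)]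
    simp

theorem coeff_rk_hPoly (hr : IsRk r) {E : Finset α} (hE : E.Nonempty) :
    (hPoly r E).coeff (r E) = 0 := by
  rw [coeff_hPoly hr le_rfl]
  simp [Finset.sum_powerset_neg_one_pow_card_of_nonempty hE]

theorem exists_hPoly_mem_segCone (hr : IsRk r) {E : Finset α} (hl : ∀ e ∈ E, r {e} = 1) :
    ∃ d, hPoly r E ∈ segCone d ∧ (hPoly r E).natDegree ≤ d := by
  have hone : (1 : ℤ[X]) ∈ segCone 0 := by
    rw [← pow_zero X, ← seg_one 0]
    exact seg_mem_segCone (by omega)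
  induction h : E.card using Nat.strong_induction_on generalizing E with
  | _ m ih =>
    subst h
    rcases E.eq_empty_or_nonempty with rfl | hE
    · exact ⟨0, by rwa [hPoly_empty hr], by simp [hPoly_empty hr]⟩
    by_cases hc : Conn r E
    · obtain ⟨e, he⟩ := hE
      have hins := Finset.insert_erase he
      rcases (E.erase e).eq_empty_or_nonempty with h0 | hne
      · rw [h0, insert_empty_eq] at hins
        have h1 := hPoly_singleton hr (hl e he)
        rw [hins] at h1
        exact ⟨0, by rwa [h1], by simp [h1]⟩
      · have key := (hPair_of_conn hr (Finset.notMem_erase e E) hne (by rwa [hins])).fst_mem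
        rw [hins] at key
        refine ⟨r E - 1, key, ?_⟩
        have h1 := hr.mono (Finset.singleton_subset_iff.2 he)
        have h2 := hl e he
        refine natDegree_le_iff_coeff_eq_zero.2 fun k hk ↦ ?_
        rcases (show r E ≤ k by omega).eq_or_lt with rfl | hlt
        · exact coeff_rk_hPoly hr ⟨e, he⟩
        · exact coeff_eq_zero_of_natDegree_lt ((natDegree_hPoly_le hr E).trans_lt hlt)
    · simp only [Conn, not_forall, not_lt] at hc
      obtain ⟨U, N, hd, rfl, hU, hN, hle⟩ := hc
      have hcard := Finset.card_union_of_disjoint hd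
      have hUpos := hU.card_pos
      have hNpos := hN.card_pos
      obtain ⟨d₁, h1, h1'⟩ := ih U.card (by omega)
        (fun e he ↦ hl e (Finset.mem_union_left N he)) rfl
      obtain ⟨d₂, h2, h2'⟩ := ih N.card (by omega)
        (fun e he ↦ hl e (Finset.mem_union_right U he)) rfl
      rw [hPoly_union hr hd hle]
      exact ⟨d₁ + d₂, mul_mem_segCone h1 h2, natDegree_mul_le.trans (by omega)⟩

/-- The h-vector of the broken circuit complex is flawless. -/
theorem coeff_hPoly_le (hr : IsRk r) (E : Finset α) {k : ℕ}
    (hk : 2 * k ≤ (hPoly r E).natDegree) :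
    (hPoly r E).coeff k ≤ (hPoly r E).coeff ((hPoly r E).natDegree - k) := by
  by_cases hl : ∀ e ∈ E, r {e} = 1
  · obtain ⟨d, hd, hdeg⟩ := exists_hPoly_mem_segCone hr hl
    have h0 := coeff_le_coeff_sub_of_mem_segCone hd (k := 0) (Nat.zero_le _)
    rw [coeff_zero_hPoly hr hl, Nat.sub_zero] at h0
    have hdeg' : (hPoly r E).natDegree = d :=
      hdeg.antisymm (le_natDegree_of_ne_zero (by omega))
    rw [hdeg'] at hk ⊢
    exact coeff_le_coeff_sub_of_mem_segCone hd hk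
  · push Not at hl
    obtain ⟨e, he, hne⟩ := hl
    have h1 := hr.singleton_le e
    have h2 := hPoly_insert_of_loop hr (Finset.notMem_erase e E) (by omega)
    rw [Finset.insert_erase he] at h2
    simp [h2]

end

theorem coe_matroidRank {α : Type*} [Finite α] (M : Matroid α) (Y : Set α) :
    (matroidRank M Y : ℕ∞) = M.eRk Y := by
  obtain ⟨I, hI⟩ := M.exists_isBasis' Y
  have h : IsGreatest {m | ∃ J ⊆ Y, M.Indep J ∧ J.ncard = m} I.ncard := by
    refine ⟨⟨I, hI.subset, hI.indep, rfl⟩, ?_⟩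
    rintro _ ⟨J, hJY, hJ, rfl⟩
    have := hJ.encard_le_eRk_of_subset hJY
    rwa [← hI.encard_eq_eRk, ← J.toFinite.cast_ncard_eq, ← I.toFinite.cast_ncard_eq,
      Nat.cast_le] at this
  rw [matroidRank, h.csSup_eq, I.toFinite.cast_ncard_eq, hI.encard_eq_eRk]

theorem isRk_matroidRank {α : Type*} [Finite α] [DecidableEq α] (M : Matroid α) :
    IsRk fun S : Finset α ↦ matroidRank M S where
  empty := by simpa using coe_matroidRank M ∅
  insert_le e S := by
    have := M.eRk_insert_le_add_one e S
    rw [← coe_matroidRank, ← coe_matroidRank] at this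
    rw [Finset.coe_insert]
    exact_mod_cast this
  mono {S T} h := by
    have := M.eRk_mono (Finset.coe_subset.2 h)
    rw [← coe_matroidRank, ← coe_matroidRank] at this
    exact_mod_cast this
  submod S T := by
    have := M.eRk_submod S T
    simp only [← coe_matroidRank] at this
    rw [Finset.coe_union, Finset.coe_inter, add_comm]
    exact_mod_cast this

theorem coeff_charPoly_comp {α : Type*} [Fintype α] (M : Matroid α) (r j : ℕ) :
    ((matroidCharPoly M r).comp (X + 1)).coeff j =
      ∑ S : Finset α, (-1) ^ S.card * ((r + 1 - matroidRank M ↑S).choose j : ℤ) := by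
  rw [matroidCharPoly, Polynomial.sum_comp, finsetSum_coeff]
  refine Finset.sum_congr rfl fun S _ ↦ ?_
  rw [mul_comp, pow_comp, pow_comp, X_comp, neg_comp, one_comp,
    show (-1 : ℤ[X]) ^ S.card = C ((-1) ^ S.card) by simp, coeff_C_mul, coeff_X_add_one_pow]

/-- **Flawlessness of the h-vector of the broken circuit complex.**
If `M` is a matroid of rank `r + 1` on a finite ground set, `h` is the h-vector of its
broken circuit complex, defined by `χ_M(q+1) = Σ_{k=0}^{r+1} (−1)^k h_k q^{r+1−k}`, and
`d` is the largest index with `h d ≠ 0`, then `h k ≤ h (d - k)` for all `0 ≤ k ≤ d/2`. -/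
theorem hvector_brokenCircuit_flawless {α : Type*} [Fintype α] (M : Matroid α)
    (hE : M.E = Set.univ) (r : ℕ) (hrank : matroidRank M Set.univ = r + 1)
    (h : ℕ → ℤ)
    (hh : (matroidCharPoly M r).comp (X + 1) =
      ∑ k ∈ Finset.range (r + 2), C ((-1) ^ k * h k) * X ^ (r + 1 - k))
    (d : ℕ) (hd : d ≤ r + 1) (hd0 : h d ≠ 0) (hdmax : ∀ k ≤ r + 1, h k ≠ 0 → k ≤ d) :
    ∀ k : ℕ, 2 * k ≤ d → h k ≤ h (d - k) := by
  classical
  set ρ : Finset α → ℕ := fun S ↦ matroidRank M S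
  have hρ : IsRk ρ := isRk_matroidRank M
  have hρE : ρ Finset.univ = r + 1 := by simp only [ρ, Finset.coe_univ, hrank]
  have hcoeff : ∀ k ≤ r + 1, (hPoly ρ Finset.univ).coeff k = h k := by
    intro k hk
    have h1 := congrArg (fun p ↦ p.coeff (r + 1 - k)) hh
    simp only [coeff_charPoly_comp, finsetSum_coeff, coeff_C_mul_X_pow] at h1
    rw [Finset.sum_eq_single_of_mem k (Finset.mem_range.2 (by omega)) fun j hj hjk ↦
      if_neg (by rw [Finset.mem_range] at hj; omega), if_pos rfl] at h1
    rw [coeff_hPoly hρ (by omega), hρE, Finset.powerset_univ, h1, ← mul_assoc, ← mul_pow]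
    simp
  have hdeg : (hPoly ρ Finset.univ).natDegree = d := by
    refine le_antisymm ?_ (le_natDegree_of_ne_zero (by rwa [hcoeff d hd]))
    have h1 := natDegree_hPoly_le hρ Finset.univ
    rw [hρE] at h1
    refine hdmax _ h1 ?_
    rw [← hcoeff _ h1, coeff_natDegree, leadingCoeff_ne_zero]
    intro h0
    rw [← hcoeff d hd, h0, coeff_zero] at hd0
    exact hd0 rfl
  intro k hk
  have key := coeff_hPoly_le hρ Finset.univ (k := k) (by omega)
  rwa [hdeg, hcoeff _ (by omega), hcoeff _ (by omega)] at key
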